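/- arXiv:2209.02433 — 2 statements merged into one kernel-verified Lean document; each statement's English description precedes it below -/
import Mathlib

section
/- Let K be a semifield. If (i,a) ∼ (i',a') in ℐ×K^ν and the last letters agree, i_ν = i'_ν, then a_ν = a'_ν. Consequently, for each i∈I there is a well-defined map g'_i from the set of equivalence classes possessing a representative ending in the letter i to K, sending such a class to the last entry a_ν of any representative (i,a) with i_ν = i. -/
open scoped BigOperators

namespace Lusztig

variable {I : Type*} [Fintype I] [DecidableEq I]

/-- A simply laced Cartan matrix: symmetric, positive definite, integer entries,
`2` on the diagonal and `0` or `-1` off the diagonal. -/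
structure IsSimplyLacedCartan (A : Matrix I I ℤ) : Prop where
  symm : ∀ i j, A i j = A j i
  posDef : ∀ x : I → ℤ, x ≠ 0 → 0 < ∑ i, ∑ j, x i * A i j * x j
  diag : ∀ i, A i i = 2
  offDiag : ∀ i j, i ≠ j → A i j = 0 ∨ A i j = -1

/-- The simple reflection `s_i` acting on `ℤ[I] = I → ℤ`, `s_i(j') = j' - a_{ij} i'`. -/
def sE (A : Matrix I I ℤ) (i : I) : Function.End (I → ℤ) :=
  fun x => x - (∑ j, A i j * x j) • Pi.single i 1

/-- The length of `w`: the least `n` such that `w` is a product of `n` simple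
reflections (`∞` convention: `sInf ∅ = 0`). -/
noncomputable def len (A : Matrix I I ℤ) (w : Function.End (I → ℤ)) : ℕ :=
  sInf {n | ∃ l : List I, l.length = n ∧ (l.map (sE A)).prod = w}

/-- `w₀` is the longest element of `W = ⟨s_i⟩` and `ν = |w₀|`. -/
structure IsLongest (A : Matrix I I ℤ) (w₀ : Function.End (I → ℤ)) (ν : ℕ) : Prop where
  mem : ∃ l : List I, (l.map (sE A)).prod = w₀
  len_eq : len A w₀ = ν
  longest : ∀ w : Function.End (I → ℤ),
    (∃ l : List I, (l.map (sE A)).prod = w) → len A w ≤ ν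

/-- `ℐ`: the set of sequences `(i_1, …, i_ν)` with `s_{i_1} ⋯ s_{i_ν} = w₀`. -/
def RedWord (A : Matrix I I ℤ) (w₀ : Function.End (I → ℤ)) (ν : ℕ) :
    Set (Fin ν → I) :=
  {f | ((List.ofFn f).map (sE A)).prod = w₀}

/-- The coefficient `r_{h,k}` defined by
`s_{i_1} ⋯ s_{i_{k-1}} (i_k') = Σ_h r_{h,k} h'` (here `k` is `0`-indexed). -/
def rCoef (A : Matrix I I ℤ) {ν : ℕ} (f : Fin ν → I) (h : I) (k : Fin ν) : ℤ :=
  ((List.ofFn fun m : Fin (k : ℕ) => sE A (f (Fin.castLE k.2.le m))).prod :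
    Function.End (I → ℤ)) (Pi.single (f k) 1) h

/-- `‖i,a‖_h = Π_k a_k^{r_{h,k}}`. -/
def normAt (A : Matrix I I ℤ) {ν : ℕ} {K : Type*} [CommGroup K]
    (f : Fin ν → I) (a : Fin ν → K) (h : I) : K :=
  ∏ k : Fin ν, a k ^ rCoef A f h k

section Semifield

variable {K : Type*} [CommGroup K] [AddCommSemigroup K]

/-- Adjacency of two pairs in `ℐ × K^ν`, for a semifield `K` (written
multiplicatively, with addition `+`). -/
def Adjacent (A : Matrix I I ℤ) (w₀ : Function.End (I → ℤ)) (ν : ℕ)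
    (p q : (Fin ν → I) × (Fin ν → K)) : Prop :=
  p.1 ∈ RedWord A w₀ ν ∧ q.1 ∈ RedWord A w₀ ν ∧
  ((∃ (l : ℕ) (h0 : l < ν) (h1 : l + 1 < ν) (h2 : l + 2 < ν),
      A (p.1 ⟨l, h0⟩) (p.1 ⟨l + 1, h1⟩) = -1 ∧
      p.1 ⟨l + 2, h2⟩ = p.1 ⟨l, h0⟩ ∧
      q.1 ⟨l, h0⟩ = p.1 ⟨l + 1, h1⟩ ∧ q.1 ⟨l + 1, h1⟩ = p.1 ⟨l, h0⟩ ∧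
      q.1 ⟨l + 2, h2⟩ = p.1 ⟨l + 1, h1⟩ ∧
      (∀ k : Fin ν, (k : ℕ) ≠ l → (k : ℕ) ≠ l + 1 → (k : ℕ) ≠ l + 2 →
        q.1 k = p.1 k ∧ q.2 k = p.2 k) ∧
      q.2 ⟨l, h0⟩ =
        p.2 ⟨l + 1, h1⟩ * p.2 ⟨l + 2, h2⟩ * (p.2 ⟨l, h0⟩ + p.2 ⟨l + 2, h2⟩)⁻¹ ∧
      q.2 ⟨l + 1, h1⟩ = p.2 ⟨l, h0⟩ + p.2 ⟨l + 2, h2⟩ ∧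
      q.2 ⟨l + 2, h2⟩ =
        p.2 ⟨l, h0⟩ * p.2 ⟨l + 1, h1⟩ * (p.2 ⟨l, h0⟩ + p.2 ⟨l + 2, h2⟩)⁻¹) ∨
   (∃ (l : ℕ) (h0 : l < ν) (h1 : l + 1 < ν),
      A (p.1 ⟨l, h0⟩) (p.1 ⟨l + 1, h1⟩) = 0 ∧
      q.1 ⟨l, h0⟩ = p.1 ⟨l + 1, h1⟩ ∧ q.1 ⟨l + 1, h1⟩ = p.1 ⟨l, h0⟩ ∧
      (∀ k : Fin ν, (k : ℕ) ≠ l → (k : ℕ) ≠ l + 1 →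
        q.1 k = p.1 k ∧ q.2 k = p.2 k) ∧
      q.2 ⟨l, h0⟩ = p.2 ⟨l + 1, h1⟩ ∧ q.2 ⟨l + 1, h1⟩ = p.2 ⟨l, h0⟩))

end Semifield

/-- Adjacency of two pairs in `ℐ × ℤ^ν` for the tropical semifield `ℤ`
(sum = `min`, product = `+`). -/
def TAdjacent (A : Matrix I I ℤ) (w₀ : Function.End (I → ℤ)) (ν : ℕ)
    (p q : (Fin ν → I) × (Fin ν → ℤ)) : Prop :=
  p.1 ∈ RedWord A w₀ ν ∧ q.1 ∈ RedWord A w₀ ν ∧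
  ((∃ (l : ℕ) (h0 : l < ν) (h1 : l + 1 < ν) (h2 : l + 2 < ν),
      A (p.1 ⟨l, h0⟩) (p.1 ⟨l + 1, h1⟩) = -1 ∧
      p.1 ⟨l + 2, h2⟩ = p.1 ⟨l, h0⟩ ∧
      q.1 ⟨l, h0⟩ = p.1 ⟨l + 1, h1⟩ ∧ q.1 ⟨l + 1, h1⟩ = p.1 ⟨l, h0⟩ ∧
      q.1 ⟨l + 2, h2⟩ = p.1 ⟨l + 1, h1⟩ ∧
      (∀ k : Fin ν, (k : ℕ) ≠ l → (k : ℕ) ≠ l + 1 → (k : ℕ) ≠ l + 2 →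
        q.1 k = p.1 k ∧ q.2 k = p.2 k) ∧
      q.2 ⟨l, h0⟩ =
        p.2 ⟨l + 1, h1⟩ + p.2 ⟨l + 2, h2⟩ - min (p.2 ⟨l, h0⟩) (p.2 ⟨l + 2, h2⟩) ∧
      q.2 ⟨l + 1, h1⟩ = min (p.2 ⟨l, h0⟩) (p.2 ⟨l + 2, h2⟩) ∧
      q.2 ⟨l + 2, h2⟩ =
        p.2 ⟨l, h0⟩ + p.2 ⟨l + 1, h1⟩ - min (p.2 ⟨l, h0⟩) (p.2 ⟨l + 2, h2⟩)) ∨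
   (∃ (l : ℕ) (h0 : l < ν) (h1 : l + 1 < ν),
      A (p.1 ⟨l, h0⟩) (p.1 ⟨l + 1, h1⟩) = 0 ∧
      q.1 ⟨l, h0⟩ = p.1 ⟨l + 1, h1⟩ ∧ q.1 ⟨l + 1, h1⟩ = p.1 ⟨l, h0⟩ ∧
      (∀ k : Fin ν, (k : ℕ) ≠ l → (k : ℕ) ≠ l + 1 →
        q.1 k = p.1 k ∧ q.2 k = p.2 k) ∧
      q.2 ⟨l, h0⟩ = p.2 ⟨l + 1, h1⟩ ∧ q.2 ⟨l + 1, h1⟩ = p.2 ⟨l, h0⟩))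

/-- The symmetric bilinear form on `ℤ[I]` attached to `A`. -/
def form (A : Matrix I I ℤ) : LinearMap.BilinForm ℤ (I → ℤ) := Matrix.toBilin' A

/-- The simple root `i'`. -/
abbrev simple (i : I) : I → ℤ := Pi.single i 1

theorem form_apply (A : Matrix I I ℤ) (x y : I → ℤ) :
    form A x y = ∑ i, ∑ j, x i * A i j * y j := Matrix.toBilin'_apply A x y

theorem form_simple_left (A : Matrix I I ℤ) (i : I) (y : I → ℤ) :
    form A (simple i) y = ∑ j, A i j * y j := by
  rw [form_apply, Finset.sum_eq_single i]
  · simp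
  · intro b _ hb
    simp [Pi.single_eq_of_ne hb]
  · simp

theorem form_simple_simple (A : Matrix I I ℤ) (i j : I) :
    form A (simple i) (simple j) = A i j := Matrix.toBilin'_single A i j

section RootLattice

variable {A : Matrix I I ℤ}

theorem IsSimplyLacedCartan.form_comm (hA : IsSimplyLacedCartan A) (x y : I → ℤ) :
    form A x y = form A y x := by
  rw [form_apply, form_apply, Finset.sum_comm]
  refine Finset.sum_congr rfl fun i _ => Finset.sum_congr rfl fun j _ => ?_
  rw [hA.symm]
  ring

theorem IsSimplyLacedCartan.form_self_pos (hA : IsSimplyLacedCartan A) {x : I → ℤ}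
    (hx : x ≠ 0) : 0 < form A x x := by
  rw [form_apply]
  exact hA.posDef x hx

theorem IsSimplyLacedCartan.form_self_even (hA : IsSimplyLacedCartan A) (x : I → ℤ) :
    Even (form A x x) := by
  suffices h : ∀ s : Finset I, Even (form A (∑ i ∈ s, x i • simple i) (∑ i ∈ s, x i • simple i)) by
    have hx : ∑ i, x i • simple i = x := by
      ext k
      simp [Finset.sum_apply, Pi.single_apply]
    have h' := h Finset.univ
    rwa [hx] at h'
  intro s
  induction s using Finset.induction_on with
  | empty => simp
  | insert i s hi ih =>
    rw [Finset.sum_insert hi]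
    set y := ∑ i ∈ s, x i • simple i
    have e : form A (x i • simple i + y) (x i • simple i + y)
        = 2 * (x i * x i + x i * form A (simple i) y) + form A y y := by
      simp only [map_add, map_smul, LinearMap.add_apply, LinearMap.smul_apply, smul_eq_mul,
        hA.form_comm y (simple i), form_simple_simple, hA.diag]
      ring
    rw [e]
    exact (even_two_mul _).add ih

/-- The reflection `x ↦ x - (β, x) β`. -/
def reflection (A : Matrix I I ℤ) (β : I → ℤ) : Module.End ℤ (I → ℤ) :=
  LinearMap.id - (form A β).smulRight β

theorem reflection_apply (A : Matrix I I ℤ) (β x : I → ℤ) :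
    reflection A β x = x - form A β x • β := rfl

theorem reflection_simple_coe (A : Matrix I I ℤ) (i : I) :
    (reflection A (simple i) : (I → ℤ) → (I → ℤ)) = sE A i := by
  funext x
  rw [reflection_apply, form_simple_left]
  rfl

theorem reflection_form (hA : IsSimplyLacedCartan A) {β : I → ℤ} (hβ : form A β β = 2)
    (x y : I → ℤ) : form A (reflection A β x) (reflection A β y) = form A x y := by
  simp only [reflection_apply, map_sub, map_smul, LinearMap.sub_apply, LinearMap.smul_apply,
    smul_eq_mul, hβ, hA.form_comm x β]
  ring

theorem reflection_mul_self {β : I → ℤ} (hβ : form A β β = 2) :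
    reflection A β * reflection A β = 1 := by
  refine LinearMap.ext fun x => ?_
  simp only [Module.End.mul_apply, reflection_apply, map_sub, map_smul, hβ,
    Module.End.one_apply]
  module

theorem reflection_reflection (hA : IsSimplyLacedCartan A) {β : I → ℤ} (hβ : form A β β = 2)
    (γ : I → ℤ) :
    reflection A β * reflection A (reflection A β γ) = reflection A γ * reflection A β := by
  refine LinearMap.ext fun x => ?_
  have h := reflection_form hA hβ γ (reflection A β x)
  rw [← Module.End.mul_apply, reflection_mul_self hβ, Module.End.one_apply] at h
  rw [Module.End.mul_apply, Module.End.mul_apply, reflection_apply A (reflection A β γ),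
    reflection_apply A γ, map_sub, map_smul, h, ← Module.End.mul_apply (reflection A β),
    reflection_mul_self hβ, Module.End.one_apply]

theorem form_simple_self (hA : IsSimplyLacedCartan A) (i : I) :
    form A (simple i) (simple i) = 2 := by
  rw [form_simple_simple, hA.diag]

theorem root_ne_zero {α : I → ℤ} (hα : form A α α = 2) : α ≠ 0 := by
  rintro rfl
  simp at hα

/-- Every root has all its coordinates of one sign. -/
theorem root_nonneg_or_nonpos (hA : IsSimplyLacedCartan A) {α : I → ℤ} (hα : form A α α = 2) :
    0 ≤ α ∨ 0 ≤ -α := by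
  set β : I → ℤ := α ⊔ 0 with hβ
  set γ : I → ℤ := (-α) ⊔ 0 with hγ
  have hαβ : α = β - γ := by
    ext i
    simp only [hβ, hγ, Pi.sub_apply, Pi.sup_apply, Pi.neg_apply, Pi.zero_apply]
    omega
  have hβγ : form A β γ ≤ 0 := by
    rw [form_apply]
    refine Finset.sum_nonpos fun i _ => Finset.sum_nonpos fun j _ => ?_
    have hβi : 0 ≤ β i := le_sup_right
    have hγj : 0 ≤ γ j := le_sup_right
    by_cases hij : i = j
    · subst hij
      have : β i * γ i = 0 := by
        simp only [hβ, hγ, Pi.sup_apply, Pi.neg_apply, Pi.zero_apply]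
        rcases le_total (α i) 0 with h | h
        · rw [sup_eq_right.2 h, zero_mul]
        · rw [sup_eq_right.2 (neg_nonpos.2 h), mul_zero]
      rw [mul_right_comm, this, zero_mul]
    · have hij' : A i j ≤ 0 := by rcases hA.offDiag i j hij with h | h <;> omega
      rw [mul_right_comm]
      exact mul_nonpos_of_nonneg_of_nonpos (mul_nonneg hβi hγj) hij'
  have hsum : form A α α = form A β β + form A γ γ - 2 * form A β γ := by
    rw [hαβ]
    simp only [map_sub, LinearMap.sub_apply, hA.form_comm γ β]
    ring
  by_cases hγ0 : γ = 0
  · left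
    rw [hαβ, hγ0, sub_zero]
    exact le_sup_right
  by_cases hβ0 : β = 0
  · right
    rw [hαβ, hβ0, zero_sub, neg_neg]
    exact le_sup_right
  · exfalso
    have h1 := hA.form_self_pos hβ0
    have h2 := hA.form_self_pos hγ0
    obtain ⟨m, hm⟩ := hA.form_self_even β
    obtain ⟨n, hn⟩ := hA.form_self_even γ
    omega

theorem form_le_two (hA : IsSimplyLacedCartan A) {α β : I → ℤ} (hα : form A α α = 2)
    (hβ : form A β β = 2) : form A α β ≤ 2 := by
  by_cases h : α - β = 0
  · rw [sub_eq_zero.1 h, hβ]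
  · have := hA.form_self_pos h
    simp only [map_sub, LinearMap.sub_apply, hA.form_comm β α] at this
    omega

theorem eq_of_form_eq_two (hA : IsSimplyLacedCartan A) {α β : I → ℤ} (hα : form A α α = 2)
    (hβ : form A β β = 2) (h : form A α β = 2) : α = β := by
  by_contra hne
  have := hA.form_self_pos (sub_ne_zero.2 hne)
  simp only [map_sub, LinearMap.sub_apply, hA.form_comm β α] at this
  omega

theorem neg_two_le_form (hA : IsSimplyLacedCartan A) {α β : I → ℤ} (hα : form A α α = 2)
    (hβ : form A β β = 2) : -2 ≤ form A α β := by
  have := form_le_two hA hα (β := -β) (by simpa using hβ)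
  simp only [map_neg] at this
  omega

/-- A simple reflection makes only its own simple root negative. -/
theorem eq_simple_of_reflection_not_nonneg (hA : IsSimplyLacedCartan A) {β : I → ℤ}
    (hβ : form A β β = 2) (h0 : 0 ≤ β) {i : I} (h : ¬ 0 ≤ reflection A (simple i) β) :
    β = simple i := by
  have hroot : form A (reflection A (simple i) β) (reflection A (simple i) β) = 2 := by
    rw [reflection_form hA (form_simple_self hA i), hβ]
  have hneg := (root_nonneg_or_nonpos hA hroot).resolve_left h
  have hsingle : β = β i • simple i := by
    ext k
    by_cases hk : k = i
    · subst hk; simp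
    · have h1 := hneg k
      have h2 := h0 k
      simp only [reflection_apply, Pi.zero_apply, Pi.neg_apply, Pi.sub_apply, Pi.smul_apply,
        Pi.single_eq_of_ne hk, smul_zero, sub_zero] at h1 h2 ⊢
      omega
  have h2 : β i * (β i * 2) = 2 := by
    rw [hsingle] at hβ
    simpa only [map_smul, LinearMap.smul_apply, smul_eq_mul, form_simple_simple, hA.diag] using hβ
  have h3 := h0 i
  have h4 : β i = 1 := by
    have : β i * β i = 1 := by linarith
    have h5 : (0 : ℤ) ≤ β i := h3
    nlinarith
  rw [hsingle, h4, one_smul]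

/-- The product of the simple reflections of a word. -/
def wordProd (A : Matrix I I ℤ) (l : List I) : Module.End ℤ (I → ℤ) :=
  (l.map fun i => reflection A (simple i)).prod

theorem wordProd_coe (A : Matrix I I ℤ) (l : List I) :
    (wordProd A l : (I → ℤ) → (I → ℤ)) = (l.map (sE A)).prod := by
  induction l with
  | nil => rfl
  | cons i l ih =>
    rw [wordProd, List.map_cons, List.prod_cons, List.map_cons, List.prod_cons, ← ih,
      ← reflection_simple_coe]
    rfl

theorem wordProd_cons (A : Matrix I I ℤ) (i : I) (l : List I) :
    wordProd A (i :: l) = reflection A (simple i) * wordProd A l := by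
  simp [wordProd]

theorem wordProd_append (A : Matrix I I ℤ) (l l' : List I) :
    wordProd A (l ++ l') = wordProd A l * wordProd A l' := by
  simp [wordProd]

theorem wordProd_reverse_mul (hA : IsSimplyLacedCartan A) (l : List I) :
    wordProd A l.reverse * wordProd A l = 1 := by
  induction l with
  | nil => simp [wordProd]
  | cons i l ih =>
    rw [List.reverse_cons, wordProd_append, wordProd_cons, wordProd_cons, mul_assoc,
      ← mul_assoc _ _ (wordProd A l), ← mul_assoc _ _ (wordProd A l)]
    have h1 : wordProd A [] = 1 := rfl
    rw [h1, mul_one, reflection_mul_self (form_simple_self hA i), mul_one, ih]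

theorem wordProd_mul_reverse (hA : IsSimplyLacedCartan A) (l : List I) :
    wordProd A l * wordProd A l.reverse = 1 := by
  simpa using wordProd_reverse_mul hA l.reverse

theorem form_wordProd (hA : IsSimplyLacedCartan A) (l : List I) (x y : I → ℤ) :
    form A (wordProd A l x) (wordProd A l y) = form A x y := by
  induction l with
  | nil => simp [wordProd]
  | cons i l ih =>
    rw [wordProd_cons, Module.End.mul_apply, Module.End.mul_apply,
      reflection_form hA (form_simple_self hA i), ih]

/-- The exchange condition. -/
theorem exists_exchange (hA : IsSimplyLacedCartan A) (l : List I) {β : I → ℤ}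
    (hβ : form A β β = 2) (h0 : 0 ≤ β) (h : ¬ 0 ≤ wordProd A l.reverse β) :
    ∃ l' : List I, l'.length < l.length ∧ reflection A β * wordProd A l = wordProd A l' := by
  induction l generalizing β with
  | nil => exact absurd h0 (by simpa [wordProd] using h)
  | cons j t ih =>
    have hj := form_simple_self hA j
    by_cases hs : 0 ≤ reflection A (simple j) β
    · have h' : ¬ 0 ≤ wordProd A t.reverse (reflection A (simple j) β) := by
        rw [List.reverse_cons, wordProd_append] at h
        simpa [wordProd] using h
      obtain ⟨t', ht', e⟩ := ih (by rw [reflection_form hA hj, hβ]) hs h'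
      refine ⟨j :: t', by simpa using ht', ?_⟩
      rw [wordProd_cons, wordProd_cons, ← e, ← mul_assoc, ← mul_assoc,
        reflection_reflection hA hj]
    · refine ⟨t, by simp, ?_⟩
      rw [eq_simple_of_reflection_not_nonneg hA hβ h0 hs, wordProd_cons, ← mul_assoc,
        reflection_mul_self hj, one_mul]

/-- A word is reduced if no shorter word has the same product. -/
def IsReduced (A : Matrix I I ℤ) (l : List I) : Prop :=
  ∀ l' : List I, wordProd A l' = wordProd A l → l.length ≤ l'.length

theorem IsReduced.tail {i : I} {l : List I} (h : IsReduced A (i :: l)) : IsReduced A l := by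
  intro l' hl'
  simpa using h (i :: l') (by rw [wordProd_cons, wordProd_cons, hl'])

theorem IsReduced.of_append {l l₂ : List I} (h : IsReduced A (l ++ l₂)) : IsReduced A l := by
  intro l' hl'
  simpa using h (l' ++ l₂) (by rw [wordProd_append, wordProd_append, hl'])

theorem IsReduced.nonneg (hA : IsSimplyLacedCartan A) {i : I} {l : List I}
    (h : IsReduced A (i :: l)) : 0 ≤ wordProd A l.reverse (simple i) := by
  by_contra hneg
  have hi : (0 : I → ℤ) ≤ simple i := Pi.single_nonneg.2 zero_le_one
  obtain ⟨l', hl', e⟩ := exists_exchange hA l (form_simple_self hA i) hi hneg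
  have := h l' (by rw [wordProd_cons, e])
  simp only [List.length_cons] at this
  omega

end RootLattice

/-- The roots: the vectors of norm `2` of the root lattice. -/
abbrev Root (A : Matrix I I ℤ) : Type _ := {α : I → ℤ // form A α α = 2}

/-- The pairing of a root with the `i`-th simple coroot. -/
def pairing {A : Matrix I I ℤ} (α : Root A) (i : I) : ℤ := form A (simple i) α.1

/-- A real vector space with coordinates indexed by the roots and by `I`, underlying the adjoint
representation. -/
abbrev Adj (A : Matrix I I ℤ) : Type _ := (Root A → ℝ) × (I → ℝ)

/-- The linear form on the zero weight space through which the `i`-th root vectors act. -/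
def cartanForm (A : Matrix I I ℤ) (i : I) (u : I → ℝ) : ℝ := ∑ j, |(A i j : ℝ)| * u j

theorem cartanForm_add_single (A : Matrix I I ℤ) (i j : I) (u : I → ℝ) (c : ℝ) :
    cartanForm A i (u + Pi.single j c) = cartanForm A i u + |(A i j : ℝ)| * c := by
  simp [cartanForm, mul_add, Finset.sum_add_distrib, Pi.single_apply]

namespace IsSimplyLacedCartan

variable {A : Matrix I I ℤ}

/-- The `i`-th simple root, as a root. -/
def simpleRoot (hA : IsSimplyLacedCartan A) (i : I) : Root A := ⟨simple i, form_simple_self hA i⟩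

/-- The `i`-th simple reflection acting on the roots. -/
def refl (hA : IsSimplyLacedCartan A) (i : I) (α : Root A) : Root A :=
  ⟨reflection A (simple i) α.1, by rw [reflection_form hA (form_simple_self hA i), α.2]⟩

@[simp] theorem refl_refl (hA : IsSimplyLacedCartan A) (i : I) (α : Root A) :
    hA.refl i (hA.refl i α) = α :=
  Subtype.ext (LinearMap.congr_fun (reflection_mul_self (form_simple_self hA i)) α.1)

@[simp] theorem pairing_simpleRoot (hA : IsSimplyLacedCartan A) (i j : I) :
    pairing (hA.simpleRoot j) i = A i j :=
  form_simple_simple A i j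

@[simp] theorem pairing_refl (hA : IsSimplyLacedCartan A) (i j : I) (α : Root A) :
    pairing (hA.refl j α) i = pairing α i - A i j * pairing α j := by
  simp only [pairing, refl, reflection_apply, map_sub, map_smul, form_simple_simple, smul_eq_mul]
  ring

theorem coe_refl (hA : IsSimplyLacedCartan A) (i : I) (α : Root A) :
    (hA.refl i α).1 = α.1 - pairing α i • simple i := rfl

theorem refl_simpleRoot_coe (hA : IsSimplyLacedCartan A) (i : I) :
    (hA.refl i (hA.simpleRoot i)).1 = -simple i := by
  rw [coe_refl, pairing_simpleRoot, hA.diag]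
  simp only [simpleRoot]
  module

theorem pairing_le_two (hA : IsSimplyLacedCartan A) (α : Root A) (i : I) : pairing α i ≤ 2 :=
  form_le_two hA (form_simple_self hA i) α.2

theorem neg_two_le_pairing (hA : IsSimplyLacedCartan A) (α : Root A) (i : I) : -2 ≤ pairing α i :=
  neg_two_le_form hA (form_simple_self hA i) α.2

theorem eq_simpleRoot (hA : IsSimplyLacedCartan A) {α : Root A} {i : I} (h : pairing α i = 2) :
    α = hA.simpleRoot i :=
  Subtype.ext (eq_of_form_eq_two hA (form_simple_self hA i) α.2 h).symm

theorem eq_refl_simpleRoot (hA : IsSimplyLacedCartan A) {α : Root A} {i : I}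
    (h : pairing α i = -2) : α = hA.refl i (hA.simpleRoot i) := by
  rw [← hA.refl_refl i α, hA.eq_simpleRoot (α := hA.refl i α) (i := i)
    (by rw [pairing_refl, hA.diag, h]; rfl)]

theorem refl_of_pairing_eq_zero (hA : IsSimplyLacedCartan A) {α : Root A} {i : I}
    (h : pairing α i = 0) : hA.refl i α = α :=
  Subtype.ext (by rw [coe_refl, h, zero_smul, sub_zero])

theorem refl_simpleRoot_comm (hA : IsSimplyLacedCartan A) {i j : I} (h : A i j = -1) :
    hA.refl i (hA.simpleRoot j) = hA.refl j (hA.simpleRoot i) := by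
  refine Subtype.ext ?_
  rw [coe_refl, coe_refl, pairing_simpleRoot, pairing_simpleRoot, hA.symm j i, h]
  simp only [simpleRoot]
  module

theorem pairing_add_le_two (hA : IsSimplyLacedCartan A) {i j : I} (h : A i j = -1) (α : Root A) :
    pairing α i + pairing α j ≤ 2 := by
  have := hA.pairing_le_two (hA.refl j α) i
  rw [pairing_refl, h] at this
  omega

theorem neg_two_le_pairing_add (hA : IsSimplyLacedCartan A) {i j : I} (h : A i j = -1)
    (α : Root A) : -2 ≤ pairing α i + pairing α j := by
  have := hA.neg_two_le_pairing (hA.refl j α) i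
  rw [pairing_refl, h] at this
  omega

theorem eq_of_pairing_one_one (hA : IsSimplyLacedCartan A) {i j : I} (h : A i j = -1)
    {α : Root A} (hi : pairing α i = 1) (hj : pairing α j = 1) :
    α = hA.refl j (hA.simpleRoot i) := by
  rw [← hA.refl_refl j α, hA.eq_simpleRoot (α := hA.refl j α) (i := i)
    (by rw [pairing_refl, h, hi, hj]; rfl)]

/-- The one-parameter subgroup `x_i` of the positive simple root acting on `Adj A`. -/
def raise (hA : IsSimplyLacedCartan A) (i : I) (a : ℝ) : Function.End (Adj A) := fun v =>
  (fun α => v.1 α + if pairing α i = 2 then a * cartanForm A i v.2 + a ^ 2 * v.1 (hA.refl i α)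
      else if pairing α i = 1 then a * v.1 (hA.refl i α) else 0,
    v.2 + Pi.single i (a * v.1 (hA.refl i (hA.simpleRoot i))))

/-- The one-parameter subgroup `y_i` of the negative simple root acting on `Adj A`. -/
def lower (hA : IsSimplyLacedCartan A) (i : I) (t : ℝ) : Function.End (Adj A) := fun v =>
  (fun α => v.1 α + if pairing α i = -2 then t * cartanForm A i v.2 + t ^ 2 * v.1 (hA.refl i α)
      else if pairing α i = -1 then t * v.1 (hA.refl i α) else 0,
    v.2 + Pi.single i (t * v.1 (hA.simpleRoot i)))

/-- The one-parameter subgroup of the simple coroot acting on `Adj A`. -/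
noncomputable def torus (A : Matrix I I ℤ) (i : I) (c : ℝ) : Function.End (Adj A) := fun v =>
  (fun α => c ^ pairing α i * v.1 α, v.2)

theorem pairing_cases (hA : IsSimplyLacedCartan A) (α : Root A) (i : I) :
    pairing α i = -2 ∨ pairing α i = -1 ∨ pairing α i = 0 ∨ pairing α i = 1 ∨ pairing α i = 2 := by
  have h1 := hA.pairing_le_two α i
  have h2 := hA.neg_two_le_pairing α i
  omega

theorem raise_add (hA : IsSimplyLacedCartan A) (i : I) (a b : ℝ) :
    hA.raise i (a + b) = hA.raise i a * hA.raise i b := by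
  funext v
  refine Prod.ext (funext fun α => ?_) ?_
  · change _ = (hA.raise i a (hA.raise i b v)).1 α
    rcases hA.pairing_cases α i with h | h | h | h | h
    · simp [raise, h]
    · simp [raise, h]
    · simp [raise, h]
    · simp [raise, h, hA.diag]
      ring
    · obtain rfl := hA.eq_simpleRoot h
      simp [raise, hA.diag, cartanForm_add_single]
      ring
  · change _ = (hA.raise i a (hA.raise i b v)).2
    simp [raise, hA.diag, add_assoc, ← Pi.single_add]
    ring_nf

theorem lower_add (hA : IsSimplyLacedCartan A) (i : I) (a b : ℝ) :
    hA.lower i (a + b) = hA.lower i a * hA.lower i b := by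
  funext v
  refine Prod.ext (funext fun α => ?_) ?_
  · change _ = (hA.lower i a (hA.lower i b v)).1 α
    rcases hA.pairing_cases α i with h | h | h | h | h
    · obtain rfl := hA.eq_refl_simpleRoot h
      simp [lower, hA.diag, cartanForm_add_single]
      ring
    · simp [lower, h, hA.diag]
      ring
    · simp [lower, h]
    · simp [lower, h]
    · simp [lower, h]
  · change _ = (hA.lower i a (hA.lower i b v)).2
    simp [lower, hA.diag, add_assoc, ← Pi.single_add]
    ring_nf

theorem raise_zero (hA : IsSimplyLacedCartan A) (i : I) : hA.raise i 0 = 1 := by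
  funext v
  refine Prod.ext (funext fun α => ?_) ?_ <;> simp [raise] <;> rfl

theorem lower_zero (hA : IsSimplyLacedCartan A) (i : I) : hA.lower i 0 = 1 := by
  funext v
  refine Prod.ext (funext fun α => ?_) ?_ <;> simp [lower] <;> rfl

theorem raise_comm (hA : IsSimplyLacedCartan A) {i j : I} (h : A i j = 0) (a b : ℝ) :
    hA.raise i a * hA.raise j b = hA.raise j b * hA.raise i a := by
  have hs : A j i = 0 := by rw [hA.symm, h]
  funext v
  refine Prod.ext (funext fun α => ?_) ?_
  · change (hA.raise i a (hA.raise j b v)).1 α = (hA.raise j b (hA.raise i a v)).1 α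
    have hc : hA.refl i (hA.refl j α) = hA.refl j (hA.refl i α) := Subtype.ext (by
      rw [coe_refl, coe_refl, coe_refl, coe_refl, pairing_refl, pairing_refl, h, hs]
      module)
    rcases hA.pairing_cases α i with hi | hi | hi | hi | hi <;>
    rcases hA.pairing_cases α j with hj | hj | hj | hj | hj <;>
    simp [raise, hi, hj, h, hs, cartanForm_add_single, hc]
    all_goals first
      | ring1
      | (obtain rfl := hA.eq_simpleRoot hi; simp [hs] at hj)
      | (obtain rfl := hA.eq_simpleRoot hj; simp [h] at hi)
  · change (hA.raise i a (hA.raise j b v)).2 = (hA.raise j b (hA.raise i a v)).2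
    simp [raise, h, hs, hA.diag, add_assoc, add_comm, add_left_comm]

theorem refl_refl_simpleRoot (hA : IsSimplyLacedCartan A) {i j : I} (h : A i j = -1) :
    hA.refl j (hA.refl i (hA.simpleRoot i)) = hA.refl i (hA.refl j (hA.simpleRoot j)) := by
  have hs : A j i = -1 := by rw [hA.symm, h]
  refine Subtype.ext ?_
  rw [coe_refl, coe_refl, coe_refl, coe_refl]
  simp only [pairing_refl, pairing_simpleRoot, hA.diag, h, hs]
  simp only [simpleRoot]
  module

theorem raise_braid (hA : IsSimplyLacedCartan A) {i j : I} (h : A i j = -1) {a b c : ℝ}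
    (hac : a + c ≠ 0) :
    hA.raise i a * hA.raise j b * hA.raise i c =
      hA.raise j (b * c * (a + c)⁻¹) * hA.raise i (a + c) * hA.raise j (a * b * (a + c)⁻¹) := by
  have hs : A j i = -1 := by rw [hA.symm, h]
  have hr := hA.refl_refl_simpleRoot h
  funext v
  refine Prod.ext (funext fun α => ?_) ?_
  · change (hA.raise i a (hA.raise j b (hA.raise i c v))).1 α =
      (hA.raise j _ (hA.raise i _ (hA.raise j _ v))).1 α
    have h1 := hA.pairing_add_le_two h α
    have h2 := hA.neg_two_le_pairing_add h α
    rcases hA.pairing_cases α i with hi | hi | hi | hi | hi <;>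
    rcases hA.pairing_cases α j with hj | hj | hj | hj | hj <;>
    simp [raise, hi, hj, h, hs, hA.diag, cartanForm_add_single]
    all_goals try omega
    all_goals first
      | (obtain rfl := hA.eq_simpleRoot hi; simp [hs] at hj; done)
      | (obtain rfl := hA.eq_simpleRoot hj; simp [h] at hi; done)
      | (obtain rfl := hA.eq_simpleRoot hi; rw [hr]; field_simp; ring1)
      | (obtain rfl := hA.eq_simpleRoot hj; rw [hr]; field_simp; ring1)
      | (rw [show hA.refl j α = hA.simpleRoot i by
            rw [hA.eq_of_pairing_one_one h hi hj, refl_refl],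
          show hA.refl i α = hA.simpleRoot j by
            rw [hA.eq_of_pairing_one_one hs hj hi, refl_refl], hr]; field_simp; ring1)
      | (field_simp; ring1)
  · change (hA.raise i a (hA.raise j b (hA.raise i c v))).2 =
      (hA.raise j _ (hA.raise i _ (hA.raise j _ v))).2
    simp [raise, h, hs, hA.diag, hr]
    have hij : i ≠ j := by
      rintro rfl
      simp [hA.diag] at h
    funext k
    by_cases hki : k = i
    · subst hki
      simp [hij]
      field_simp
      ring
    · by_cases hkj : k = j
      · subst hkj
        simp [hij.symm]
        field_simp
        ring
      · simp [hki, hkj]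

theorem raise_lower_comm (hA : IsSimplyLacedCartan A) {i j : I} (hij : i ≠ j) (a t : ℝ) :
    hA.raise i a * hA.lower j t = hA.lower j t * hA.raise i a := by
  have hA2 := hA.offDiag i j hij
  funext v
  refine Prod.ext (funext fun α => ?_) ?_
  · change (hA.raise i a (hA.lower j t v)).1 α = (hA.lower j t (hA.raise i a v)).1 α
    rcases hA2 with h | h <;> have hs := (hA.symm j i).trans h
    · have hc : hA.refl i (hA.refl j α) = hA.refl j (hA.refl i α) := Subtype.ext (by
        rw [coe_refl, coe_refl, coe_refl, coe_refl, pairing_refl, pairing_refl, h, hs]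
        module)
      rcases hA.pairing_cases α i with hi | hi | hi | hi | hi <;>
      rcases hA.pairing_cases α j with hj | hj | hj | hj | hj <;>
      simp [raise, lower, hi, hj, h, hs, cartanForm_add_single, hc]
      all_goals first
        | ring1
        | (obtain rfl := hA.eq_simpleRoot hi; simp [hs] at hj)
        | (obtain rfl := hA.eq_refl_simpleRoot hj; simp [h] at hi)
    · have hr := hA.refl_refl_simpleRoot h
      rcases hA.pairing_cases α i with hi | hi | hi | hi | hi <;>
      rcases hA.pairing_cases α j with hj | hj | hj | hj | hj <;>
      simp [raise, lower, hi, hj, h, hs, hA.diag, cartanForm_add_single]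
      all_goals first
        | ring1
        | (obtain rfl := hA.eq_simpleRoot hi; simp [hs] at hj; done)
        | (obtain rfl := hA.eq_refl_simpleRoot hj; simp [h, hA.diag] at hi; done)
        | (obtain rfl := hA.eq_simpleRoot hi; rw [← hA.refl_simpleRoot_comm h, refl_refl]; ring1)
        | (obtain rfl := hA.eq_refl_simpleRoot hj; simp only [← hr, refl_refl]; ring1)
  · change (hA.raise i a (hA.lower j t v)).2 = (hA.lower j t (hA.raise i a v)).2
    rcases hA2 with h | h <;> have hs := (hA.symm j i).trans h <;>
    simp [raise, lower, h, hs, hA.diag]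
    all_goals exact add_right_comm _ _ _

theorem raise_mul_lower (hA : IsSimplyLacedCartan A) (i : I) {a t c : ℝ} (hc : c = 1 + a * t)
    (h : c ≠ 0) :
    hA.raise i a * hA.lower i t = hA.lower i (t / c) * torus A i c * hA.raise i (a / c) := by
  funext v
  refine Prod.ext (funext fun α => ?_) ?_
  · change (hA.raise i a (hA.lower i t v)).1 α =
      (hA.lower i _ (torus A i _ (hA.raise i _ v))).1 α
    rcases hA.pairing_cases α i with hi | hi | hi | hi | hi <;>
    simp [raise, lower, torus, hi, hA.diag, cartanForm_add_single]
    · obtain rfl := hA.eq_refl_simpleRoot hi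
      simp
      field_simp
      rw [hc]
      ring
    · field_simp
      rw [hc]
      ring
    · field_simp
      rw [hc]
      ring
    · obtain rfl := hA.eq_simpleRoot hi
      field_simp
      rw [hc]
      ring
  · change (hA.raise i a (hA.lower i t v)).2 =
      (hA.lower i _ (torus A i _ (hA.raise i _ v))).2
    simp [raise, lower, torus, hA.diag, add_assoc]
    rw [← Pi.single_add, ← Pi.single_add]
    congr 1
    field_simp
    rw [hc]
    ring

theorem raise_mul_torus (hA : IsSimplyLacedCartan A) (i j : I) (a : ℝ) {c : ℝ} (hc : c ≠ 0) :
    hA.raise j a * torus A i c = torus A i c * hA.raise j (a * (c ^ A i j)⁻¹) := by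
  have e : c ^ (A i j - A i j * 2) = (c ^ A i j)⁻¹ := by
    rw [← zpow_neg]
    congr 1
    ring
  funext v
  refine Prod.ext (funext fun α => ?_) ?_
  · change (hA.raise j a (torus A i c v)).1 α = (torus A i c (hA.raise j _ v)).1 α
    rcases hA.pairing_cases α j with hj | hj | hj | hj | hj <;>
    simp [raise, torus, hj]
    · rw [zpow_sub₀ hc]
      field_simp
    · obtain rfl := hA.eq_simpleRoot hj
      simp [e]
      field_simp
  · change (hA.raise j a (torus A i c v)).2 = (torus A i c (hA.raise j _ v)).2
    simp [raise, torus, hA.diag, e, mul_assoc]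

theorem raise_neg_apply (hA : IsSimplyLacedCartan A) (i : I) (a : ℝ) (v : Adj A) :
    hA.raise i a (hA.raise i (-a) v) = v := by
  change (hA.raise i a * hA.raise i (-a)) v = v
  rw [← raise_add, add_neg_cancel, raise_zero]
  rfl

theorem lower_neg_apply (hA : IsSimplyLacedCartan A) (i : I) (t : ℝ) (v : Adj A) :
    hA.lower i t (hA.lower i (-t) v) = v := by
  change (hA.lower i t * hA.lower i (-t)) v = v
  rw [← lower_add, add_neg_cancel, lower_zero]
  rfl

/-- The vectors whose zero weight component vanishes and which are supported on the roots sent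
by `g` to negative roots. -/
def inversionSpace (A : Matrix I I ℤ) (g : Module.End ℤ (I → ℤ)) : Set (Adj A) :=
  {v | v.2 = 0 ∧ ∀ α : Root A, 0 ≤ g α.1 → v.1 α = 0}

theorem lower_raise_snd (hA : IsSimplyLacedCartan A) (i : I) {a : ℝ} (ha : a ≠ 0) (v : Adj A) :
    (hA.lower i (-a⁻¹) (hA.raise i a v)).2 =
      v.2 - Pi.single i (v.1 (hA.simpleRoot i) / a + cartanForm A i v.2) := by
  simp [raise, lower, hA.diag, add_assoc]
  rw [← Pi.single_add, sub_eq_add_neg, ← Pi.single_neg]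
  congr 2
  field_simp
  ring

theorem lower_raise_mem_inversionSpace (hA : IsSimplyLacedCartan A) {i : I} {a : ℝ} (ha : a ≠ 0)
    {g : Module.End ℤ (I → ℤ)} (hg : 0 ≤ g (simple i)) (v : Adj A) :
    hA.lower i (-a⁻¹) (hA.raise i a v) ∈ inversionSpace A (g * reflection A (simple i)) ↔
      v ∈ inversionSpace A g := by
  have hrefl : ∀ α : Root A, (g * reflection A (simple i)) α.1 = g (hA.refl i α).1 :=
    fun α => rfl
  have hrefl' : ∀ α : Root A, (g * reflection A (simple i)) (hA.refl i α).1 = g α.1 :=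
    fun α => by rw [hrefl, refl_refl]
  have hone : ∀ α : Root A, pairing α i = 1 → 0 ≤ g (hA.refl i α).1 → 0 ≤ g α.1 := by
    intro α hα h
    rw [coe_refl, hα, one_smul, map_sub] at h
    simpa using add_nonneg h hg
  constructor
  · rintro ⟨h2, h1⟩
    have hsimple : v.1 (hA.simpleRoot i) = 0 := by
      have := h1 (hA.refl i (hA.simpleRoot i)) (by rw [hrefl']; exact hg)
      have e : (hA.lower i (-a⁻¹) (hA.raise i a v)).1 (hA.refl i (hA.simpleRoot i)) =
          v.1 (hA.simpleRoot i) / a ^ 2 := by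
        simp [raise, lower, hA.diag, cartanForm_add_single]
        field_simp
        ring
      simpa [e, ha] using this
    rw [lower_raise_snd hA i ha, hsimple, zero_div, zero_add, sub_eq_zero] at h2
    have hu : cartanForm A i v.2 = 0 := by
      have := cartanForm_add_single A i i 0 (cartanForm A i v.2)
      rw [zero_add, ← h2, hA.diag] at this
      simp [cartanForm] at this
      simp only [cartanForm]
      linarith
    have hu' : v.2 = 0 := by rw [h2, hu, Pi.single_zero]
    have key : ∀ α : Root A, pairing α i = 1 → 0 ≤ g α.1 → v.1 α = 0 := by
      intro α hα h
      have := h1 (hA.refl i α) (by rwa [hrefl'])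
      simp [raise, lower, hA.diag, hα] at this
      field_simp at this
      linarith
    refine ⟨hu', fun α h => ?_⟩
    have hN := h1 (hA.refl i α) (by rwa [hrefl'])
    rcases hA.pairing_cases α i with hi | hi | hi | hi | hi
    · obtain rfl := hA.eq_refl_simpleRoot hi
      simp [raise, lower, hA.diag, hsimple, hu] at hN
      simpa [ha] using hN
    · have := key (hA.refl i α) (by simp [hi, hA.diag])
        (hone _ (by simp [hi, hA.diag]) (by rwa [refl_refl]))
      simp [raise, lower, hA.diag, hi, this] at hN
      simpa [ha] using hN
    · rw [hA.refl_of_pairing_eq_zero hi] at hN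
      simpa [raise, lower, hi] using hN
    · exact key α hi h
    · obtain rfl := hA.eq_simpleRoot hi
      exact hsimple
  · rintro ⟨h2, h1⟩
    have hsimple : v.1 (hA.simpleRoot i) = 0 := h1 _ hg
    refine ⟨?_, fun α h => ?_⟩
    · rw [lower_raise_snd hA i ha, h2, hsimple]
      simp [cartanForm]
    · rw [hrefl] at h
      have h' := h1 _ h
      rcases hA.pairing_cases α i with hi | hi | hi | hi | hi
      · obtain rfl := hA.eq_refl_simpleRoot hi
        have hu : cartanForm A i v.2 = 0 := by simp [h2, cartanForm]
        simp [raise, lower, hA.diag, hsimple, cartanForm_add_single, hu]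
        field_simp
        ring
      · simp [raise, lower, hA.diag, hi, h']
        field_simp
        ring
      · rw [hA.refl_of_pairing_eq_zero hi] at h'
        simp [raise, lower, hA.diag, hi, h']
      · simp [raise, lower, hA.diag, hi, h', h1 α (hone α hi h)]
      · obtain rfl := hA.eq_simpleRoot hi
        simp [raise, lower, hA.diag, h', hsimple, h2, cartanForm]

theorem raise_image_inversionSpace (hA : IsSimplyLacedCartan A) {i : I} {a : ℝ} (ha : a ≠ 0)
    {g : Module.End ℤ (I → ℤ)} (hg : 0 ≤ g (simple i)) :
    hA.raise i a '' inversionSpace A g =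
      hA.lower i a⁻¹ '' inversionSpace A (g * reflection A (simple i)) := by
  ext w
  constructor
  · rintro ⟨v, hv, rfl⟩
    exact ⟨_, (lower_raise_mem_inversionSpace hA ha hg v).2 hv, lower_neg_apply hA i a⁻¹ _⟩
  · rintro ⟨w, hw, rfl⟩
    refine ⟨hA.raise i (-a) (hA.lower i a⁻¹ w), ?_, raise_neg_apply hA i a _⟩
    rw [← lower_raise_mem_inversionSpace hA ha hg, raise_neg_apply]
    have := lower_neg_apply hA i (-a⁻¹) w
    rw [neg_neg] at this
    rwa [this]

/-- The monoid generated by the positive parts of the one-parameter subgroups of the lower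
triangular Borel subgroup. -/
def lowerMonoid (hA : IsSimplyLacedCartan A) : Submonoid (Function.End (Adj A)) :=
  Submonoid.closure
    ({f | ∃ j t, 0 < t ∧ f = hA.lower j t} ∪ {f | ∃ j c, 0 < c ∧ f = torus A j c})

theorem lower_mem_lowerMonoid (hA : IsSimplyLacedCartan A) (j : I) {t : ℝ} (ht : 0 < t) :
    hA.lower j t ∈ hA.lowerMonoid := Submonoid.subset_closure (Or.inl ⟨j, t, ht, rfl⟩)

theorem torus_mem_lowerMonoid (hA : IsSimplyLacedCartan A) (j : I) {c : ℝ} (hc : 0 < c) :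
    torus A j c ∈ hA.lowerMonoid := Submonoid.subset_closure (Or.inr ⟨j, c, hc, rfl⟩)

theorem exists_raise_mul (hA : IsSimplyLacedCartan A) {b : Function.End (Adj A)}
    (hb : b ∈ hA.lowerMonoid) (i : I) {a : ℝ} (ha : 0 < a) :
    ∃ b' ∈ hA.lowerMonoid, ∃ a' : ℝ, 0 < a' ∧ hA.raise i a * b = b' * hA.raise i a' := by
  induction hb using Submonoid.closure_induction generalizing a with
  | mem b hb =>
    rcases hb with ⟨j, t, ht, rfl⟩ | ⟨j, c, hc, rfl⟩
    · by_cases hij : i = j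
      · subst hij
        have hc : 0 < 1 + a * t := by positivity
        exact ⟨_, mul_mem (lower_mem_lowerMonoid hA i (div_pos ht hc))
          (torus_mem_lowerMonoid hA i hc), _, div_pos ha hc, hA.raise_mul_lower i rfl hc.ne'⟩
      · exact ⟨_, lower_mem_lowerMonoid hA j ht, a, ha, hA.raise_lower_comm hij a t⟩
    · exact ⟨_, torus_mem_lowerMonoid hA j hc, _, by positivity, hA.raise_mul_torus j i a hc.ne'⟩
  | one => exact ⟨1, one_mem _, a, ha, by rw [mul_one, one_mul]⟩
  | mul b₁ b₂ _ _ ih₁ ih₂ =>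
    obtain ⟨b₁', hb₁, a₁, ha₁, e₁⟩ := ih₁ ha
    obtain ⟨b₂', hb₂, a₂, ha₂, e₂⟩ := ih₂ ha₁
    exact ⟨_, mul_mem hb₁ hb₂, a₂, ha₂, by rw [← mul_assoc, e₁, mul_assoc, e₂, mul_assoc]⟩

/-- The product of the operators `x_i(a)` over a list of pairs `(i, a)`. -/
def raiseProd (hA : IsSimplyLacedCartan A) (l : List (I × ℝ)) : Function.End (Adj A) :=
  (l.map fun p => hA.raise p.1 p.2).prod

theorem mul_image (f g : Function.End (Adj A)) (s : Set (Adj A)) :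
    (f * g) '' s = f '' (g '' s) := Set.image_comp f g s

theorem exists_raiseProd_image (hA : IsSimplyLacedCartan A) (l : List (I × ℝ))
    (hpos : ∀ p ∈ l, 0 < p.2) (hl : IsReduced A (l.map Prod.fst)) :
    ∃ b ∈ hA.lowerMonoid, hA.raiseProd l '' inversionSpace A 1 =
      b '' inversionSpace A (wordProd A (l.map Prod.fst).reverse) := by
  induction l with
  | nil => exact ⟨1, one_mem _, rfl⟩
  | cons p l ih =>
    obtain ⟨b, hb, e⟩ := ih (fun q hq => hpos q (List.mem_cons_of_mem _ hq)) hl.tail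
    obtain ⟨b', hb', a', ha', e'⟩ := exists_raise_mul hA hb p.1 (hpos p List.mem_cons_self)
    refine ⟨b' * hA.lower p.1 a'⁻¹, mul_mem hb' (lower_mem_lowerMonoid hA _ (inv_pos.2 ha')), ?_⟩
    have hg : 0 ≤ wordProd A (l.map Prod.fst).reverse (simple p.1) := IsReduced.nonneg hA hl
    have hp : hA.raiseProd (p :: l) = hA.raise p.1 p.2 * hA.raiseProd l := by simp [raiseProd]
    rw [hp, mul_image, e, ← mul_image, e', mul_image, mul_image,
      hA.raise_image_inversionSpace ha'.ne' hg, List.map_cons, List.reverse_cons, wordProd_append]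
    simp [wordProd]

/-- The sum of the coordinates of a root. -/
def height (α : Root A) : ℤ := ∑ k, α.1 k

/-- The vectors whose components of height at least that of `γ` vanish, except for the
component of `γ`. -/
def below (γ : Root A) : Set (Adj A) :=
  {v | ∀ α : Root A, height γ ≤ height α → α ≠ γ → v.1 α = 0}

theorem height_refl (hA : IsSimplyLacedCartan A) (i : I) (α : Root A) :
    height (hA.refl i α) = height α - pairing α i := by
  simp [height, coe_refl, Finset.sum_sub_distrib, Pi.single_apply]

theorem height_pos {γ : Root A} (h : 0 ≤ γ.1) : 0 < height γ := by
  refine lt_of_le_of_ne (Finset.sum_nonneg fun k _ => h k) fun h0 => root_ne_zero γ.2 ?_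
  funext k
  exact (Finset.sum_eq_zero_iff_of_nonneg fun k _ => h k).1 h0.symm k (Finset.mem_univ k)

theorem lower_apply_of_height (hA : IsSimplyLacedCartan A) {γ : Root A} (hγ : 0 ≤ γ.1) (j : I)
    (t : ℝ) {v : Adj A} (hv : v ∈ below γ) {α : Root A} (hα : height γ ≤ height α) :
    (hA.lower j t v).1 α = v.1 α := by
  have hpos := height_pos hγ
  have h2 : pairing α j ≠ -2 := by
    intro h
    have e := hA.eq_refl_simpleRoot h
    have : height α = -1 := by
      rw [e, height_refl, pairing_simpleRoot, hA.diag]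
      simp [height, simpleRoot]
    omega
  by_cases h1 : pairing α j = -1
  · have hr := hA.height_refl j α
    have := hv (hA.refl j α) (by omega) (by rintro rfl; omega)
    simp [lower, h1, this]
  · simp [lower, h1, h2]

theorem lower_mem_below (hA : IsSimplyLacedCartan A) {γ : Root A} (hγ : 0 ≤ γ.1) (j : I) (t : ℝ)
    {v : Adj A} (hv : v ∈ below γ) : hA.lower j t v ∈ below γ := fun α hα hne => by
  rw [lower_apply_of_height hA hγ j t hv hα, hv α hα hne]

theorem lowerMonoid_below (hA : IsSimplyLacedCartan A) {γ : Root A} (hγ : 0 ≤ γ.1)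
    {b : Function.End (Adj A)} (hb : b ∈ hA.lowerMonoid) :
    ∃ c : ℝ, c ≠ 0 ∧ ∀ v : Adj A, (b v ∈ below γ ↔ v ∈ below γ) ∧
      (v ∈ below γ → (b v).1 γ = c * v.1 γ) := by
  induction hb using Submonoid.closure_induction with
  | mem b hb =>
    rcases hb with ⟨j, t, ht, rfl⟩ | ⟨j, c, hc, rfl⟩
    · refine ⟨1, one_ne_zero, fun v => ⟨⟨fun h => ?_, lower_mem_below hA hγ j t⟩, fun h => ?_⟩⟩
      · have := lower_mem_below hA hγ j (-t) h
        have e := lower_neg_apply hA j (-t) v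
        rw [neg_neg] at e
        rwa [e] at this
      · rw [lower_apply_of_height hA hγ j t h le_rfl, one_mul]
    · refine ⟨c ^ pairing γ j, zpow_ne_zero _ hc.ne', fun v => ⟨?_, fun _ => rfl⟩⟩
      refine forall₃_congr fun α _ _ => ?_
      simp [torus, zpow_ne_zero _ hc.ne']
  | one => exact ⟨1, one_ne_zero, fun v => ⟨Iff.rfl, fun _ => (one_mul _).symm⟩⟩
  | mul b₁ b₂ _ _ ih₁ ih₂ =>
    obtain ⟨c₁, hc₁, h₁⟩ := ih₁
    obtain ⟨c₂, hc₂, h₂⟩ := ih₂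
    refine ⟨c₁ * c₂, mul_ne_zero hc₁ hc₂, fun v =>
      ⟨(h₁ (b₂ v)).1.trans (h₂ v).1, fun hv => ?_⟩⟩
    rw [mul_assoc, ← (h₂ v).2 hv]
    exact (h₁ (b₂ v)).2 ((h₂ v).1.2 hv)

theorem not_nonneg_of_image_subset (hA : IsSimplyLacedCartan A) {b b' : Function.End (Adj A)}
    (hb : b ∈ hA.lowerMonoid) (hb' : b' ∈ hA.lowerMonoid) {g g' : Module.End ℤ (I → ℤ)}
    (h : b '' inversionSpace A g ⊆ b' '' inversionSpace A g') {γ : Root A} (hγ : 0 ≤ γ.1)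
    (hg : ¬ 0 ≤ g γ.1) : ¬ 0 ≤ g' γ.1 := by
  classical
  obtain ⟨c, hc, hbγ⟩ := lowerMonoid_below hA hγ hb
  obtain ⟨c', -, hbγ'⟩ := lowerMonoid_below hA hγ hb'
  set x : Adj A := (Pi.single γ 1, 0)
  have hx : x ∈ below γ := fun α _ hne => Pi.single_eq_of_ne hne 1
  obtain ⟨v, hv, e⟩ := h ⟨x, ⟨rfl, fun α hα => Pi.single_eq_of_ne (by rintro rfl; exact hg hα) 1⟩,
    rfl⟩
  have hvγ : v ∈ below γ := by rwa [← (hbγ' v).1, e, (hbγ x).1]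
  intro h0
  have h1 := (hbγ x).2 hx
  rw [← e, (hbγ' v).2 hvγ, hv.2 γ h0] at h1
  simp [x] at h1
  exact hc h1.symm

theorem raiseProd_mul_ne (hA : IsSimplyLacedCartan A) {l l' : List (I × ℝ)} {i : I} {c : ℝ}
    (hpos : ∀ p ∈ l, 0 < p.2) (hpos' : ∀ p ∈ l', 0 < p.2) (hc : 0 < c)
    (hl : IsReduced A (l.map Prod.fst ++ [i])) (hl' : IsReduced A (l'.map Prod.fst))
    (hw : wordProd A (l.map Prod.fst) = wordProd A (l'.map Prod.fst)) :
    hA.raiseProd (l ++ [(i, c)]) ≠ hA.raiseProd l' := by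
  intro heq
  obtain ⟨b, hb, e⟩ := exists_raiseProd_image hA (l ++ [(i, c)])
    (by simpa [or_imp, forall_and, hc] using hpos) (by simpa using hl)
  obtain ⟨b', hb', e'⟩ := exists_raiseProd_image hA l' hpos' hl'
  rw [heq, e'] at e
  set w := wordProd A (l'.map Prod.fst)
  set g := wordProd A (l'.map Prod.fst).reverse with hg
  have hgw : g * w = 1 := wordProd_reverse_mul hA _
  have hg' : wordProd A (((l ++ [(i, c)]).map Prod.fst).reverse) = reflection A (simple i) * g := by
    have h1 : wordProd A (l.map Prod.fst).reverse = g := by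
      have h2 := wordProd_mul_reverse hA (l.map Prod.fst)
      rw [hw] at h2
      exact (left_inv_eq_right_inv hgw h2).symm
    simp [wordProd_cons, h1]
  rw [hg'] at e
  have hroot : form A (w (simple i)) (w (simple i)) = 2 := by
    rw [form_wordProd hA, form_simple_self hA]
  have hgi : g (w (simple i)) = simple i := LinearMap.congr_fun hgw (simple i)
  have hsi : reflection A (simple i) (simple i) = -simple i := hA.refl_simpleRoot_coe i
  rcases root_nonneg_or_nonpos hA hroot with h0 | h0
  · refine not_nonneg_of_image_subset hA hb hb' e.ge (γ := ⟨_, hroot⟩) h0 ?_ ?_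
    · simp [Module.End.mul_apply, hgi, hsi]
    · simp [hgi]
  · refine not_nonneg_of_image_subset hA hb' hb e.le (γ := ⟨-w (simple i), by simpa⟩) h0 ?_ ?_
    · simp [hgi]
    · simp [Module.End.mul_apply, hgi, hsi]

theorem raiseProd_append_singleton (hA : IsSimplyLacedCartan A) (l : List (I × ℝ)) (i : I)
    (a : ℝ) : hA.raiseProd (l ++ [(i, a)]) = hA.raiseProd l * hA.raise i a := by
  simp [raiseProd]

/-- The last parameter is determined by the last letter and the product of a reduced
factorization with positive parameters. -/
theorem last_param_eq (hA : IsSimplyLacedCartan A) {l l' : List (I × ℝ)} {i : I} {a a' : ℝ}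
    (hpos : ∀ p ∈ l, 0 < p.2) (hpos' : ∀ p ∈ l', 0 < p.2)
    (hl : IsReduced A (l.map Prod.fst ++ [i])) (hl' : IsReduced A (l'.map Prod.fst ++ [i]))
    (hw : wordProd A (l.map Prod.fst) = wordProd A (l'.map Prod.fst))
    (h : hA.raiseProd (l ++ [(i, a)]) = hA.raiseProd (l' ++ [(i, a')])) : a = a' := by
  suffices key : ∀ {l l' : List (I × ℝ)} {a a' : ℝ}, (∀ p ∈ l, 0 < p.2) → (∀ p ∈ l', 0 < p.2) →
      IsReduced A (l.map Prod.fst ++ [i]) → IsReduced A (l'.map Prod.fst ++ [i]) →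
      wordProd A (l.map Prod.fst) = wordProd A (l'.map Prod.fst) →
      hA.raiseProd (l ++ [(i, a)]) = hA.raiseProd (l' ++ [(i, a')]) → a ≤ a' from
    le_antisymm (key hpos hpos' hl hl' hw h) (key hpos' hpos hl' hl hw.symm h.symm)
  intro l l' a a' hpos hpos' hl hl' hw h
  by_contra! hlt
  refine raiseProd_mul_ne hA hpos hpos' (sub_pos.2 hlt) hl hl'.of_append hw ?_
  rw [raiseProd_append_singleton, raiseProd_append_singleton] at h
  rw [raiseProd_append_singleton, sub_eq_add_neg, raise_add, ← mul_assoc, h, mul_assoc,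
    ← raise_add, add_neg_cancel, raise_zero, mul_one]

end IsSimplyLacedCartan

section Interpolation

universe u

open MvPolynomial

theorem exists_semiring_embedding {K : Type u} [CommGroup K] [AddCommSemigroup K]
    (hdist : ∀ a b c : K, a * (b + c) = a * b + a * c) :
    ∃ (S : Type u) (_ : CommSemiring S) (ι : K →* S), Function.Injective ι ∧
      ∀ a b, ι (a + b) = ι a + ι b := by
  let R : CommSemiring (WithZero K) :=
    { (inferInstance : CommMonoidWithZero (WithZero K)),
      (inferInstance : AddCommMonoid (WithZero K)) with
      left_distrib := by
        intro a b c
        induction a <;> induction b <;> induction c <;>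
          simp [← WithZero.coe_add, ← WithZero.coe_mul, hdist]
      right_distrib := by
        intro a b c
        rw [mul_comm, mul_comm a, mul_comm b]
        induction a <;> induction b <;> induction c <;>
          simp [← WithZero.coe_add, ← WithZero.coe_mul, hdist] }
  exact ⟨WithZero K, R, ⟨⟨fun a => (a : WithZero K), rfl⟩, fun _ _ => rfl⟩, WithZero.coe_injective,
    fun _ _ => rfl⟩

theorem aeval_mem_of_ne_zero {σ R : Type*} [CommSemiring R] (T : Set R) (h1 : 1 ∈ T)
    (hadd : ∀ a ∈ T, ∀ b ∈ T, a + b ∈ T) (hmul : ∀ a ∈ T, ∀ b ∈ T, a * b ∈ T) {z : σ → R}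
    (hz : ∀ k, z k ∈ T) {P : MvPolynomial σ ℕ} (hP : P ≠ 0) : aeval z P ∈ T := by
  suffices h : P = 0 ∨ aeval z P ∈ T from h.resolve_left hP
  clear hP
  induction P using MvPolynomial.induction_on with
  | C n =>
    induction n with
    | zero => exact Or.inl (map_zero _)
    | succ n ih =>
      refine Or.inr ?_
      rw [map_add, map_add, map_one, map_one]
      rcases ih with h | h
      · simpa [h] using h1
      · exact hadd _ h _ h1
  | add P Q hP hQ =>
    rcases hP with rfl | hP
    · simpa using hQ
    · rcases hQ with rfl | hQ
      · simpa using Or.inr hP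
      · exact Or.inr (by simpa using hadd _ hP _ hQ)
  | mul_X P k hP =>
    rcases hP with rfl | hP
    · simp
    · exact Or.inr (by simpa using hmul _ hP _ (hz k))

theorem aeval_pos_of_ne_zero {σ : Type*} {x : σ → ℝ} (hx : ∀ k, 0 < x k)
    {P : MvPolynomial σ ℕ} (hP : P ≠ 0) : 0 < aeval x P :=
  aeval_mem_of_ne_zero (Set.Ioi (0 : ℝ)) (Set.mem_Ioi.2 one_pos)
    (fun _ ha _ hb => add_pos (Set.mem_Ioi.1 ha) (Set.mem_Ioi.1 hb))
    (fun _ ha _ hb => mul_pos (Set.mem_Ioi.1 ha) (Set.mem_Ioi.1 hb)) hx hP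

variable {K S : Type*} [CommGroup K] [CommSemiring S] {σ : Type*}

/-- The function `f` is given at the points with positive coordinates by a subtraction-free
rational expression whose value at `a` is `κ`. -/
def Interpolates (ι : K →* S) (a : σ → K) (f : (σ → ℝ) → ℝ) (κ : K) : Prop :=
  ∃ P Q : MvPolynomial σ ℕ, P ≠ 0 ∧ Q ≠ 0 ∧
    (∀ x : σ → ℝ, (∀ k, 0 < x k) → f x * aeval x Q = aeval x P) ∧
    aeval (fun k => ι (a k)) Q * ι κ = aeval (fun k => ι (a k)) P

namespace Interpolates

variable {ι : K →* S} {a : σ → K} {f g : (σ → ℝ) → ℝ} {κ μ : K}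

theorem coord (ι : K →* S) (a : σ → K) (k : σ) : Interpolates ι a (fun x => x k) (a k) :=
  ⟨X k, 1, X_ne_zero k, one_ne_zero, fun x _ => by simp, by simp⟩

theorem pos (hf : Interpolates ι a f κ) {x : σ → ℝ} (hx : ∀ k, 0 < x k) : 0 < f x := by
  obtain ⟨P, Q, hP, hQ, h, -⟩ := hf
  have := aeval_pos_of_ne_zero hx hP
  rw [← h x hx] at this
  exact pos_of_mul_pos_left this (aeval_pos_of_ne_zero hx hQ).le

theorem mul (hf : Interpolates ι a f κ) (hg : Interpolates ι a g μ) :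
    Interpolates ι a (fun x => f x * g x) (κ * μ) := by
  obtain ⟨P, Q, hP, hQ, h, e⟩ := hf
  obtain ⟨P', Q', hP', hQ', h', e'⟩ := hg
  refine ⟨P * P', Q * Q', mul_ne_zero hP hP', mul_ne_zero hQ hQ', fun x hx => ?_, ?_⟩
  · rw [map_mul, map_mul, ← h x hx, ← h' x hx]
    ring
  · rw [map_mul, map_mul, map_mul, ← e, ← e']
    ring

theorem add [AddCommSemigroup K] (hι : ∀ a b, ι (a + b) = ι a + ι b) (hf : Interpolates ι a f κ)
    (hg : Interpolates ι a g μ) : Interpolates ι a (fun x => f x + g x) (κ + μ) := by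
  obtain ⟨P, Q, hP, hQ, h, e⟩ := hf
  obtain ⟨P', Q', hP', hQ', h', e'⟩ := hg
  refine ⟨P * Q' + P' * Q, Q * Q', fun h0 => ?_, mul_ne_zero hQ hQ', fun x hx => ?_, ?_⟩
  · have h1 : ∀ k : σ, (0 : ℝ) < 1 := fun _ => one_pos
    have h2 := congrArg (aeval fun _ : σ => (1 : ℝ)) h0
    have h3 := aeval_pos_of_ne_zero h1 (mul_ne_zero hP hQ')
    have h4 := aeval_pos_of_ne_zero h1 (mul_ne_zero hP' hQ)
    rw [map_add, map_zero] at h2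
    linarith
  · rw [map_add, map_mul, map_mul, map_mul, ← h x hx, ← h' x hx]
    ring
  · rw [hι, map_add, map_mul, map_mul, map_mul, ← e, ← e']
    ring

theorem inv (hf : Interpolates ι a f κ) : Interpolates ι a (fun x => (f x)⁻¹) κ⁻¹ := by
  have hpos := fun x hx => hf.pos (x := x) hx
  obtain ⟨P, Q, hP, hQ, h, e⟩ := hf
  refine ⟨Q, P, hQ, hP, fun x hx => ?_, ?_⟩
  · rw [← h x hx, inv_mul_cancel_left₀ (hpos x hx).ne']
  · rw [← e, mul_assoc, ← map_mul, mul_inv_cancel, map_one, mul_one]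

theorem eq_of_eq_coord [AddCommSemigroup K] (hinj : Function.Injective ι)
    (hι : ∀ a b, ι (a + b) = ι a + ι b) (hf : Interpolates ι a f κ) {k : σ}
    (h : ∀ x : σ → ℝ, (∀ k, 0 < x k) → f x = x k) : κ = a k := by
  obtain ⟨P, Q, hP, hQ, hPQ, e⟩ := hf
  have hPX : P = X k * Q := by
    have hinj : Function.Injective (algebraMap ℕ ℝ) := Nat.cast_injective
    refine map_injective _ hinj (funext_set (fun _ => Set.Ioi 0) (fun _ => Set.Ioi_infinite 0)
      fun x hx => ?_)
    have hx' : ∀ k, 0 < x k := fun k => hx k trivial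
    have := hPQ x hx'
    rw [h x hx'] at this
    simpa [aeval_def, eval_map] using this.symm
  rw [hPX, map_mul, aeval_X] at e
  obtain ⟨μ, hμ⟩ := aeval_mem_of_ne_zero (Set.range ι) ⟨1, map_one ι⟩
    (by rintro _ ⟨a, rfl⟩ _ ⟨b, rfl⟩; exact ⟨a + b, hι a b⟩)
    (by rintro _ ⟨a, rfl⟩ _ ⟨b, rfl⟩; exact ⟨a * b, map_mul ι a b⟩)
    (fun k => ⟨a k, rfl⟩ : ∀ k, ι (a k) ∈ Set.range ι) hQ
  rw [← hμ, mul_comm, ← map_mul, ← map_mul] at e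
  exact mul_right_cancel (hinj e)

end Interpolates

end Interpolation

theorem prod_ofFn_congr_two {M : Type*} [Monoid M] (l : ℕ) {n : ℕ} {F G : Fin n → M}
    (h0 : l < n) (h1 : l + 1 < n)
    (hne : ∀ k : Fin n, (k : ℕ) ≠ l → (k : ℕ) ≠ l + 1 → G k = F k)
    (h : F ⟨l, h0⟩ * F ⟨l + 1, h1⟩ = G ⟨l, h0⟩ * G ⟨l + 1, h1⟩) :
    (List.ofFn F).prod = (List.ofFn G).prod := by
  induction l generalizing n with
  | zero =>
    obtain ⟨m, rfl⟩ := Nat.exists_eq_add_of_le' (show 2 ≤ n by omega)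
    have e : (fun i : Fin m => G i.succ.succ) = fun i => F i.succ.succ :=
      funext fun i => hne _ (by simp) (by simp)
    simp only [List.ofFn_succ, List.prod_cons, ← mul_assoc]
    rw [e]
    exact congrArg (· * _) h
  | succ l ih =>
    obtain ⟨m, rfl⟩ := Nat.exists_eq_add_of_le' (show 1 ≤ n by omega)
    simp only [List.ofFn_succ, List.prod_cons]
    rw [hne 0 (by simp) (by simp), ih (by omega) (by omega)
      (fun k hk hk' => hne k.succ (by simpa using hk) (by simpa using hk')) h]

theorem prod_ofFn_congr_three {M : Type*} [Monoid M] (l : ℕ) {n : ℕ} {F G : Fin n → M}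
    (h0 : l < n) (h1 : l + 1 < n) (h2 : l + 2 < n)
    (hne : ∀ k : Fin n, (k : ℕ) ≠ l → (k : ℕ) ≠ l + 1 → (k : ℕ) ≠ l + 2 → G k = F k)
    (h : F ⟨l, h0⟩ * F ⟨l + 1, h1⟩ * F ⟨l + 2, h2⟩ =
      G ⟨l, h0⟩ * G ⟨l + 1, h1⟩ * G ⟨l + 2, h2⟩) :
    (List.ofFn F).prod = (List.ofFn G).prod := by
  induction l generalizing n with
  | zero =>
    obtain ⟨m, rfl⟩ := Nat.exists_eq_add_of_le' (show 3 ≤ n by omega)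
    have e : (fun i : Fin m => G i.succ.succ.succ) = fun i => F i.succ.succ.succ :=
      funext fun i => hne _ (by simp) (by simp) (by simp)
    simp only [List.ofFn_succ, List.prod_cons, ← mul_assoc]
    rw [e]
    exact congrArg (· * _) h
  | succ l ih =>
    obtain ⟨m, rfl⟩ := Nat.exists_eq_add_of_le' (show 1 ≤ n by omega)
    simp only [List.ofFn_succ, List.prod_cons]
    rw [hne 0 (by simp) (by simp) (by simp), ih (by omega) (by omega) (by omega)
      (fun k hk hk' hk'' => hne k.succ (by simpa using hk) (by simpa using hk')
        (by simpa using hk'')) h]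

section Transport

variable {A : Matrix I I ℤ} {w₀ : Function.End (I → ℤ)} {ν : ℕ} {K S : Type*} [CommGroup K]
  [CommSemiring S]

/-- Interpolations of the entries of `p` can be transported to interpolations of the entries
of `q`, without changing the product of the corresponding operators. -/
def Transports (hA : IsSimplyLacedCartan A) (ι : K →* S) (a : Fin ν → K)
    (p q : (Fin ν → I) × (Fin ν → K)) : Prop :=
  ∀ f : Fin ν → (Fin ν → ℝ) → ℝ, (∀ k, Interpolates ι a (f k) (p.2 k)) →
    ∃ g : Fin ν → (Fin ν → ℝ) → ℝ, (∀ k, Interpolates ι a (g k) (q.2 k)) ∧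
      ∀ x : Fin ν → ℝ, (∀ k, 0 < x k) →
        (List.ofFn fun k => hA.raise (p.1 k) (f k x)).prod =
          (List.ofFn fun k => hA.raise (q.1 k) (g k x)).prod

theorem Transports.trans {hA : IsSimplyLacedCartan A} {ι : K →* S} {a : Fin ν → K}
    {p q r : (Fin ν → I) × (Fin ν → K)} (h : Transports hA ι a p q)
    (h' : Transports hA ι a q r) : Transports hA ι a p r := fun f hf => by
  obtain ⟨g, hg, e⟩ := h f hf
  obtain ⟨u, hu, e'⟩ := h' g hg
  exact ⟨u, hu, fun x hx => (e x hx).trans (e' x hx)⟩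

variable [AddCommSemigroup K]

theorem Adjacent.symm (hA : IsSimplyLacedCartan A)
    (hdist : ∀ a b c : K, a * (b + c) = a * b + a * c) {p q : (Fin ν → I) × (Fin ν → K)}
    (h : Adjacent A w₀ ν p q) : Adjacent A w₀ ν q p := by
  obtain ⟨hp, hq, h⟩ := h
  refine ⟨hq, hp, ?_⟩
  rcases h with ⟨l, h0, h1, h2, hij, hp2, hq0, hq1, hq2, hne, e0, e1, e2⟩ |
    ⟨l, h0, h1, hij, hq0, hq1, hne, e0, e1⟩
  · refine Or.inl ⟨l, h0, h1, h2, ?_, ?_, ?_, ?_, ?_,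
      fun k k0 k1 k2 => ⟨(hne k k0 k1 k2).1.symm, (hne k k0 k1 k2).2.symm⟩, ?_⟩
    · rw [hq0, hq1, hA.symm, hij]
    · rw [hq2, hq0]
    · rw [hq1]
    · rw [hq0]
    · rw [hq1, hp2]
    · rw [e0, e1, e2]
      generalize p.2 ⟨l, h0⟩ = a
      generalize p.2 ⟨l + 1, h1⟩ = b
      generalize p.2 ⟨l + 2, h2⟩ = c
      have hs : b * c * (a + c)⁻¹ + a * b * (a + c)⁻¹ = b := by
        rw [mul_right_comm b c, mul_comm a b, mul_right_comm b a, ← hdist, add_comm c a,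
          inv_mul_cancel_right]
      rw [hs]
      refine ⟨?_, rfl, ?_⟩
      · rw [mul_comm (a + c), inv_mul_cancel_right, mul_inv_cancel_right]
      · rw [inv_mul_cancel_right, mul_comm b c, mul_inv_cancel_right]
  · refine Or.inr ⟨l, h0, h1, ?_, hq1.symm, hq0.symm,
      fun k k0 k1 => ⟨(hne k k0 k1).1.symm, (hne k k0 k1).2.symm⟩, e1.symm, e0.symm⟩
    rw [hq0, hq1, hA.symm, hij]

theorem Adjacent.transports (hA : IsSimplyLacedCartan A) {ι : K →* S}
    (hι : ∀ a b, ι (a + b) = ι a + ι b) (a : Fin ν → K) {p q : (Fin ν → I) × (Fin ν → K)}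
    (h : Adjacent A w₀ ν p q) : Transports hA ι a p q := by
  intro f hf
  obtain ⟨-, -, h⟩ := h
  rcases h with ⟨l, h0, h1, h2, hij, hp2, hq0, hq1, hq2, hne, e0, e1, e2⟩ |
    ⟨l, h0, h1, hij, hq0, hq1, hne, e0, e1⟩
  · let g : Fin ν → (Fin ν → ℝ) → ℝ := fun k =>
      if (k : ℕ) = l then
        fun x => f ⟨l + 1, h1⟩ x * f ⟨l + 2, h2⟩ x * (f ⟨l, h0⟩ x + f ⟨l + 2, h2⟩ x)⁻¹
      else if (k : ℕ) = l + 1 then fun x => f ⟨l, h0⟩ x + f ⟨l + 2, h2⟩ x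
      else if (k : ℕ) = l + 2 then
        fun x => f ⟨l, h0⟩ x * f ⟨l + 1, h1⟩ x * (f ⟨l, h0⟩ x + f ⟨l + 2, h2⟩ x)⁻¹
      else f k
    refine ⟨g, fun k => ?_, fun x hx => ?_⟩
    · by_cases k0 : (k : ℕ) = l
      · obtain rfl : k = ⟨l, h0⟩ := Fin.ext k0
        simp only [g, if_true]
        rw [e0]
        exact ((hf _).mul (hf _)).mul ((hf _).add hι (hf _)).inv
      by_cases k1 : (k : ℕ) = l + 1
      · obtain rfl : k = ⟨l + 1, h1⟩ := Fin.ext k1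
        simp only [g, if_neg k0, if_true]
        rw [e1]
        exact (hf _).add hι (hf _)
      by_cases k2 : (k : ℕ) = l + 2
      · obtain rfl : k = ⟨l + 2, h2⟩ := Fin.ext k2
        simp only [g, if_neg k0, if_neg k1, if_true]
        rw [e2]
        exact ((hf _).mul (hf _)).mul ((hf _).add hι (hf _)).inv
      simp only [g, if_neg k0, if_neg k1, if_neg k2]
      rw [(hne k k0 k1 k2).2]
      exact hf k
    · refine prod_ofFn_congr_three l h0 h1 h2 (fun k k0 k1 k2 => ?_) ?_
      · simp only [g, if_neg k0, if_neg k1, if_neg k2]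
        rw [(hne k k0 k1 k2).1]
      · have hac := (add_pos ((hf ⟨l, h0⟩).pos hx) ((hf ⟨l + 2, h2⟩).pos hx)).ne'
        simpa [g, hq0, hq1, hq2, hp2] using hA.raise_braid hij hac
  · let g : Fin ν → (Fin ν → ℝ) → ℝ := fun k =>
      if (k : ℕ) = l then f ⟨l + 1, h1⟩ else if (k : ℕ) = l + 1 then f ⟨l, h0⟩ else f k
    refine ⟨g, fun k => ?_, fun x _ => ?_⟩
    · by_cases k0 : (k : ℕ) = l
      · obtain rfl : k = ⟨l, h0⟩ := Fin.ext k0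
        simp only [g, if_true]
        rw [e0]
        exact hf _
      by_cases k1 : (k : ℕ) = l + 1
      · obtain rfl : k = ⟨l + 1, h1⟩ := Fin.ext k1
        simp only [g, if_neg k0, if_true]
        rw [e1]
        exact hf _
      simp only [g, if_neg k0, if_neg k1]
      rw [(hne k k0 k1).2]
      exact hf k
    · refine prod_ofFn_congr_two l h0 h1 (fun k k0 k1 => ?_) ?_
      · simp only [g, if_neg k0, if_neg k1]
        rw [(hne k k0 k1).1]
      · simpa [g, hq0, hq1] using hA.raise_comm hij _ _

theorem transports_of_eqvGen (hA : IsSimplyLacedCartan A)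
    (hdist : ∀ a b c : K, a * (b + c) = a * b + a * c) {ι : K →* S}
    (hι : ∀ a b, ι (a + b) = ι a + ι b) (a : Fin ν → K) {p q : (Fin ν → I) × (Fin ν → K)}
    (h : Relation.EqvGen (Adjacent A w₀ ν) p q) :
    Transports hA ι a p q ∧ Transports hA ι a q p := by
  induction h with
  | rel p q h => exact ⟨h.transports hA hι a, (h.symm hA hdist).transports hA hι a⟩
  | refl p => exact ⟨fun f hf => ⟨f, hf, fun _ _ => rfl⟩, fun f hf => ⟨f, hf, fun _ _ => rfl⟩⟩
  | symm p q _ ih => exact ih.symm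
  | trans p q r _ _ ih ih' => exact ⟨ih.1.trans ih'.1, ih'.2.trans ih.2⟩

theorem eq_or_redWord_of_eqvGen {p q : (Fin ν → I) × (Fin ν → K)}
    (h : Relation.EqvGen (Adjacent A w₀ ν) p q) :
    p = q ∨ p.1 ∈ RedWord A w₀ ν ∧ q.1 ∈ RedWord A w₀ ν := by
  induction h with
  | rel p q h => exact Or.inr ⟨h.1, h.2.1⟩
  | refl p => exact Or.inl rfl
  | symm p q _ ih => exact ih.imp Eq.symm And.symm
  | trans p q r _ _ ih ih' =>
    rcases ih with rfl | ih
    · exact ih'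
    · rcases ih' with rfl | ih'
      · exact Or.inr ih
      · exact Or.inr ⟨ih.1, ih'.2⟩

end Transport

theorem isReduced_of_mem_redWord {A : Matrix I I ℤ} {w₀ : Function.End (I → ℤ)} {ν : ℕ}
    (hlen : len A w₀ = ν) {f : Fin ν → I} (hf : f ∈ RedWord A w₀ ν) :
    IsReduced A (List.ofFn f) := by
  intro l' hl'
  rw [List.length_ofFn, ← hlen]
  refine Nat.sInf_le ⟨l', rfl, ?_⟩
  rw [← wordProd_coe, hl', wordProd_coe]
  exact hf

theorem last_eq_of_prod_eq {A : Matrix I I ℤ} (hA : IsSimplyLacedCartan A)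
    {w₀ : Function.End (I → ℤ)} {n : ℕ} (hlen : len A w₀ = n + 1) {f f' : Fin (n + 1) → I}
    (hf : f ∈ RedWord A w₀ (n + 1)) (hf' : f' ∈ RedWord A w₀ (n + 1))
    (hlast : f (Fin.last n) = f' (Fin.last n)) {x x' : Fin (n + 1) → ℝ} (hx : ∀ k, 0 < x k)
    (hx' : ∀ k, 0 < x' k)
    (h : (List.ofFn fun k => hA.raise (f k) (x k)).prod =
      (List.ofFn fun k => hA.raise (f' k) (x' k)).prod) :
    x (Fin.last n) = x' (Fin.last n) := by
  have hsplit : ∀ f : Fin (n + 1) → I, List.ofFn f =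
      (List.ofFn fun k : Fin n => (f k.castSucc, x k.castSucc)).map Prod.fst ++
        [f (Fin.last n)] := fun f => by
    rw [List.ofFn_succ', List.concat_eq_append, List.map_ofFn]
    rfl
  have hsplit' : ∀ f : Fin (n + 1) → I, List.ofFn f =
      (List.ofFn fun k : Fin n => (f k.castSucc, x' k.castSucc)).map Prod.fst ++
        [f (Fin.last n)] := fun f => by
    rw [List.ofFn_succ', List.concat_eq_append, List.map_ofFn]
    rfl
  have hprod : ∀ (f : Fin (n + 1) → I) (x : Fin (n + 1) → ℝ),
      (List.ofFn fun k => hA.raise (f k) (x k)).prod =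
        hA.raiseProd ((List.ofFn fun k : Fin n => (f k.castSucc, x k.castSucc)) ++
          [(f (Fin.last n), x (Fin.last n))]) := fun f x => by
    rw [List.ofFn_succ', List.concat_eq_append, IsSimplyLacedCartan.raiseProd, List.map_append,
      List.map_ofFn]
    rfl
  have hred := isReduced_of_mem_redWord hlen hf
  have hred' := isReduced_of_mem_redWord hlen hf'
  have hw : wordProd A (List.ofFn f) = wordProd A (List.ofFn f') :=
    DFunLike.coe_injective (by rw [wordProd_coe, wordProd_coe]; exact hf.trans hf'.symm)
  rw [hprod, hprod, ← hlast] at h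
  rw [hsplit, hsplit', ← hlast, wordProd_append, wordProd_append] at hw
  rw [hsplit] at hred
  rw [hsplit', ← hlast] at hred'
  refine hA.last_param_eq ?_ ?_ hred hred' ?_ h
  · simp [List.mem_ofFn, hx]
  · simp [List.mem_ofFn, hx']
  · have hr := congrArg (· * wordProd A [f (Fin.last n)]) hw
    have hs := wordProd_reverse_mul hA [f (Fin.last n)]
    rw [List.reverse_singleton] at hs
    simpa only [mul_assoc, hs, mul_one] using hr

/-- if `(i,a) ∼ (i',a')` and the last letters agree, then the last
parameters agree; hence `g'_i` is well defined on classes with a representative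
ending in `i`. -/
theorem last_entry_well_defined (A : Matrix I I ℤ) (hA : IsSimplyLacedCartan A)
    (w₀ : Function.End (I → ℤ)) (ν : ℕ) (hw : IsLongest A w₀ ν)
    {K : Type*} [CommGroup K] [AddCommSemigroup K]
    (hdist : ∀ a b c : K, a * (b + c) = a * b + a * c)
    (p q : (Fin ν → I) × (Fin ν → K))
    (hpq : Relation.EqvGen (Adjacent A w₀ ν) p q)
    (k : Fin ν) (hk : (k : ℕ) = ν - 1) (hlast : p.1 k = q.1 k) :
    p.2 k = q.2 k := by
  obtain ⟨n, rfl⟩ := Nat.exists_eq_add_of_le' (Nat.one_le_of_lt k.2)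
  obtain rfl : k = Fin.last n := Fin.ext (by simpa using hk)
  rcases eq_or_redWord_of_eqvGen hpq with rfl | ⟨hp, hq⟩
  · rfl
  obtain ⟨_, _, ι, hinj, hι⟩ := exists_semiring_embedding hdist
  obtain ⟨g, hg, e⟩ := (transports_of_eqvGen hA hdist hι p.2 hpq).1 (fun k x => x k)
    (Interpolates.coord ι p.2)
  exact ((hg (Fin.last n)).eq_of_eq_coord hinj hι fun x hx =>
    (last_eq_of_prod_eq hA hw.len_eq hp hq hlast hx (fun k => (hg k).pos hx) (e x hx)).symm).symm

end Lusztig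
end

section
/- Let K be a semifield and p = (p_i)_{i∈I} ∈ K^I. If for some (i,a) ∈ ℐ×K^ν one has (i,a) ∼ (i,(a_1·p_{i_1}, a_2·p_{i_2}, …, a_ν·p_{i_ν})), then p_i = 1 for all i ∈ I. Equivalently, the action of the group K^I on 𝒰_K induced by (i,a) ↦ (i,(a_1 p_{i_1},…,a_ν p_{i_ν})) is free. -/
open scoped BigOperators

namespace Lusztig

variable {I : Type*} [Fintype I] [DecidableEq I]

section Roots

open Matrix

variable {A : Matrix I I ℤ}

/-- The action on `ℤ[I]` of the product of simple reflections spelled by a word. -/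
def wordAct (A : Matrix I I ℤ) (l : List I) : Function.End (I → ℤ) :=
  (l.map (sE A)).prod

lemma wordAct_nil (x : I → ℤ) : wordAct A [] x = x := rfl

lemma wordAct_cons (j : I) (l : List I) (x : I → ℤ) :
    wordAct A (j :: l) x = sE A j (wordAct A l x) := by
  simp only [wordAct, List.map_cons, List.prod_cons]
  rfl

lemma wordAct_append_singleton (l : List I) (i : I) (x : I → ℤ) :
    wordAct A (l ++ [i]) x = wordAct A l (sE A i x) := by
  induction l with
  | nil => rfl
  | cons j t ih => rw [List.cons_append, wordAct_cons, wordAct_cons, ih]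

lemma sE_apply (i : I) (x : I → ℤ) : sE A i x = x - ((A *ᵥ x) i) • Pi.single i 1 := rfl

lemma sE_apply_of_ne {i h : I} (hne : h ≠ i) (x : I → ℤ) : sE A i x h = x h := by
  simp [sE_apply, hne]

lemma sE_sub_smul (i : I) (x y : I → ℤ) (c : ℤ) :
    sE A i (x - c • y) = sE A i x - c • sE A i y := by
  ext h
  simp only [sE_apply, mulVec_sub, mulVec_smul, Pi.sub_apply, Pi.smul_apply, smul_eq_mul]
  ring

lemma wordAct_sub_smul (l : List I) (x y : I → ℤ) (c : ℤ) :
    wordAct A l (x - c • y) = wordAct A l x - c • wordAct A l y := by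
  induction l with
  | nil => rfl
  | cons j t ih => simp only [wordAct_cons, ih, sE_sub_smul]

lemma wordAct_apply_of_notMem {l : List I} {h : I} (hl : h ∉ l) (x : I → ℤ) :
    wordAct A l x h = x h := by
  induction l with
  | nil => rfl
  | cons j t ih =>
    rw [List.mem_cons, not_or] at hl
    rw [wordAct_cons, sE_apply_of_ne hl.1, ih hl.2]

omit [DecidableEq I] in
lemma dotProduct_self_eq_sum (A : Matrix I I ℤ) (x : I → ℤ) :
    x ⬝ᵥ A *ᵥ x = ∑ i, ∑ j, x i * A i j * x j := by
  simp only [dotProduct, mulVec, Finset.mul_sum, mul_assoc]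

namespace IsSimplyLacedCartan

omit [DecidableEq I] in
lemma dotProduct_comm (hA : IsSimplyLacedCartan A) (x y : I → ℤ) : x ⬝ᵥ A *ᵥ y = y ⬝ᵥ A *ᵥ x := by
  have h : Aᵀ = A := by ext i j; exact hA.symm j i
  rw [dotProduct_mulVec, ← mulVec_transpose, h, _root_.dotProduct_comm]

lemma single_dotProduct_self (hA : IsSimplyLacedCartan A) (i : I) :
    (Pi.single i 1 : I → ℤ) ⬝ᵥ A *ᵥ Pi.single i 1 = 2 := by
  simp [hA.diag]

lemma dotProduct_sE (hA : IsSimplyLacedCartan A) (i : I) (x y : I → ℤ) :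
    sE A i x ⬝ᵥ A *ᵥ sE A i y = x ⬝ᵥ A *ᵥ y := by
  have h1 : x ⬝ᵥ A *ᵥ Pi.single i 1 = (A *ᵥ x) i := by
    rw [hA.dotProduct_comm]; simp
  simp only [sE_apply, mulVec_sub, mulVec_smul, dotProduct_sub, sub_dotProduct,
    smul_dotProduct, dotProduct_smul, hA.single_dotProduct_self, h1, smul_eq_mul,
    single_one_dotProduct]
  ring

lemma dotProduct_wordAct (hA : IsSimplyLacedCartan A) (l : List I) (x y : I → ℤ) :
    wordAct A l x ⬝ᵥ A *ᵥ wordAct A l y = x ⬝ᵥ A *ᵥ y := by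
  induction l with
  | nil => rfl
  | cons j t ih => rw [wordAct_cons, wordAct_cons, hA.dotProduct_sE, ih]

lemma sE_sE (hA : IsSimplyLacedCartan A) (i : I) (x : I → ℤ) : sE A i (sE A i x) = x := by
  ext h
  simp only [sE_apply, mulVec_sub, mulVec_smul, Pi.sub_apply, Pi.smul_apply, smul_eq_mul,
    mulVec_single_one, col_apply, hA.diag]
  ring

omit [DecidableEq I] in
lemma two_dvd_dotProduct_self (hA : IsSimplyLacedCartan A)
    (x : I → ℤ) : (2 : ℤ) ∣ x ⬝ᵥ A *ᵥ x := by
  rw [dotProduct_self_eq_sum, ← Finset.sum_product',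
    ← Nat.cast_ofNat (R := ℤ) (n := 2), ← ZMod.intCast_zmod_eq_zero_iff_dvd _ 2, Int.cast_sum]
  refine Finset.sum_involution (fun p _ => (p.2, p.1)) ?_ ?_ (by simp) (by simp)
  · rintro ⟨i, j⟩ -
    simp only [hA.symm j i]
    push_cast
    have := CharTwo.add_self_eq_zero ((x i : ZMod 2) * A i j * x j)
    linear_combination this
  · rintro ⟨i, j⟩ - hne heq
    obtain rfl : j = i := by simpa using congrArg Prod.fst heq
    apply hne
    simp only [hA.diag]
    push_cast
    have : (2 : ZMod 2) = 0 := rfl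
    simp [this]

omit [DecidableEq I] in
lemma two_le_dotProduct_self (hA : IsSimplyLacedCartan A)
    {x : I → ℤ} (hx : x ≠ 0) : 2 ≤ x ⬝ᵥ A *ᵥ x := by
  have h := hA.posDef x hx
  rw [← dotProduct_self_eq_sum] at h
  exact Int.le_of_dvd h (hA.two_dvd_dotProduct_self x)

omit [DecidableEq I] in
/-- A vector of square length `2` has all coordinates of one sign. -/
lemma nonneg_or_nonpos (hA : IsSimplyLacedCartan A) {x : I → ℤ} (hx : x ⬝ᵥ A *ᵥ x = 2) :
    (∀ i, 0 ≤ x i) ∨ ∀ i, x i ≤ 0 := by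
  by_contra! hcon
  obtain ⟨⟨i, hi⟩, j, hj⟩ := hcon
  have hpos : x⁺ ≠ 0 := fun h => by
    have := congrFun h j
    simp only [Pi.posPart_apply, Pi.zero_apply, posPart_eq_zero] at this
    omega
  have hneg : x⁻ ≠ 0 := fun h => by
    have := congrFun h i
    simp only [Pi.negPart_apply, Pi.zero_apply, negPart_eq_zero] at this
    omega
  have hmix : x⁺ ⬝ᵥ A *ᵥ x⁻ ≤ 0 := by
    simp only [dotProduct, mulVec, Finset.mul_sum]
    refine Finset.sum_nonpos fun k _ => Finset.sum_nonpos fun m _ => ?_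
    simp only [Pi.posPart_apply, Pi.negPart_apply]
    have hk := posPart_nonneg (x k)
    have hm := negPart_nonneg (x m)
    rcases eq_or_ne k m with rfl | hkm
    · rcases le_total 0 (x k) with h | h
      · simp [negPart_eq_zero.2 h]
      · simp [posPart_eq_zero.2 h]
    · rcases hA.offDiag k m hkm with h | h <;> rw [h]
      · simp
      · nlinarith [mul_nonneg hk hm]
  have hsplit : x ⬝ᵥ A *ᵥ x =
      x⁺ ⬝ᵥ A *ᵥ x⁺ - 2 * (x⁺ ⬝ᵥ A *ᵥ x⁻) + x⁻ ⬝ᵥ A *ᵥ x⁻ := by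
    conv_lhs => rw [← posPart_sub_negPart x]
    rw [mulVec_sub, dotProduct_sub, sub_dotProduct, sub_dotProduct,
      hA.dotProduct_comm x⁻ x⁺]
    ring
  linarith [hA.two_le_dotProduct_self hpos, hA.two_le_dotProduct_self hneg]

/-- The only positive root made negative by `s_j` is the simple root `j'`. -/
lemma eq_single_of_sE_neg (hA : IsSimplyLacedCartan A)
    {x : I → ℤ} (hx : x ⬝ᵥ A *ᵥ x = 2) (hpos : ∀ i, 0 ≤ x i)
    {j h : I} (hneg : sE A j x h < 0) : x = Pi.single j 1 := by
  obtain rfl : h = j := by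
    by_contra hne
    rw [sE_apply_of_ne hne] at hneg
    exact absurd (hpos h) (by omega)
  have hnonpos : ∀ k, sE A h x k ≤ 0 := by
    refine (hA.nonneg_or_nonpos ((hA.dotProduct_sE h x x).trans hx)).resolve_left fun hp => ?_
    exact absurd (hp h) (by omega)
  have hxs : x = x h • Pi.single h 1 := by
    ext k
    rcases eq_or_ne k h with rfl | hk
    · simp
    · have := hnonpos k
      rw [sE_apply_of_ne hk] at this
      simp [hk, le_antisymm this (hpos k)]
  have hsq : x h * x h = 1 := by
    rw [hxs] at hx
    simp only [mulVec_smul, dotProduct_smul, smul_dotProduct, hA.single_dotProduct_self,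
      smul_eq_mul] at hx
    linarith
  have h1 : x h = 1 := by nlinarith [hpos h]
  rw [hxs, h1, one_smul]

lemma wordAct_sE (hA : IsSimplyLacedCartan A) {t : List I} {i j : I}
    (h : wordAct A t (Pi.single i 1) = Pi.single j 1) (x : I → ℤ) :
    wordAct A t (sE A i x) = sE A j (wordAct A t x) := by
  rw [sE_apply i, wordAct_sub_smul, h, sE_apply]
  congr 2
  have := hA.dotProduct_wordAct t (Pi.single i 1) x
  rw [h] at this
  simpa using this.symm

/-- Exchange condition: if a word sends the simple root `i'` to a negative root, then
right multiplication by `s_i` amounts to deleting a letter. -/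
lemma exists_shorter_word (hA : IsSimplyLacedCartan A)
    {l : List I} {i h : I} (hneg : wordAct A l (Pi.single i 1) h < 0) :
    ∃ l' : List I, l'.length + 1 = l.length ∧
      ∀ x, wordAct A l (sE A i x) = wordAct A l' x := by
  induction l generalizing h with
  | nil =>
    rw [wordAct_nil] at hneg
    have : (0 : I → ℤ) ≤ Pi.single i 1 := Pi.single_nonneg.2 zero_le_one
    exact absurd (this h) (not_le.2 hneg)
  | cons j t ih =>
    by_cases ht : ∃ k, wordAct A t (Pi.single i 1) k < 0
    · obtain ⟨k, hk⟩ := ht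
      obtain ⟨l', hlen, hl'⟩ := ih hk
      exact ⟨j :: l', by simp [hlen], fun x => by rw [wordAct_cons, wordAct_cons, hl']⟩
    · push Not at ht
      rw [wordAct_cons] at hneg
      have hroot := (hA.dotProduct_wordAct t _ _).trans (hA.single_dotProduct_self i)
      have hsimple := hA.eq_single_of_sE_neg hroot ht hneg
      exact ⟨t, rfl, fun x => by rw [wordAct_cons, hA.wordAct_sE hsimple, hA.sE_sE]⟩

/-- Every simple reflection occurs in every expression of the longest element. -/
lemma mem_of_isLongest (hA : IsSimplyLacedCartan A)
    {w₀ : Function.End (I → ℤ)} {ν : ℕ} (hw : IsLongest A w₀ ν)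
    {l : List I} (hl : wordAct A l = w₀) (i : I) : i ∈ l := by
  by_contra hi
  have hle := hw.longest (wordAct A (l ++ [i])) ⟨_, rfl⟩
  obtain ⟨m, hm, hm'⟩ : ∃ m : List I, m.length = len A (wordAct A (l ++ [i])) ∧
      wordAct A m = wordAct A (l ++ [i]) :=
    Nat.sInf_mem (s := {n | ∃ m : List I, m.length = n ∧
      (m.map (sE A)).prod = wordAct A (l ++ [i])}) ⟨_, l ++ [i], rfl, rfl⟩
  have hs : sE A i (Pi.single i 1) = (0 : I → ℤ) - (1 : ℤ) • Pi.single i 1 := by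
    ext h
    simp only [sE_apply, mulVec_single_one, col_apply, hA.diag, Pi.sub_apply, Pi.smul_apply,
      smul_eq_mul, Pi.zero_apply]
    ring
  have hneg : wordAct A m (Pi.single i 1) i < 0 := by
    rw [hm', wordAct_append_singleton, wordAct_apply_of_notMem hi, hs]
    simp
  obtain ⟨l', hlen, hl'⟩ := hA.exists_shorter_word hneg
  have hl'w : wordAct A l' = w₀ := by
    funext x
    rw [← hl', hm', wordAct_append_singleton, hA.sE_sE, hl]
  have : len A w₀ ≤ l'.length := Nat.sInf_le ⟨l', rfl, hl'w⟩
  rw [hw.len_eq] at this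
  omega

end IsSimplyLacedCartan

end Roots

section LinearInvariant

lemma sum_eq_sum_of_eq_off {ι M : Type*} [Fintype ι] [DecidableEq ι] [AddCommMonoid M]
    (s : Finset ι) {F G : ι → M} (hs : ∑ k ∈ s, F k = ∑ k ∈ s, G k)
    (hoff : ∀ k ∉ s, F k = G k) : ∑ k, F k = ∑ k, G k := by
  rw [← Finset.sum_add_sum_compl s F, ← Finset.sum_add_sum_compl s G, hs,
    Finset.sum_congr rfl fun k hk => hoff k (Finset.mem_compl.1 hk)]

variable {K : Type*} [CommGroup K] [AddCommSemigroup K]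

/-- The sum, in `K` with a zero adjoined, of the coordinates `a_k` with `i_k = i`. -/
def letterSum {ν : ℕ} (i : I) (p : (Fin ν → I) × (Fin ν → K)) : WithZero K :=
  ∑ k, if p.1 k = i then (p.2 k : WithZero K) else 0

lemma Adjacent.letterSum_eq {A : Matrix I I ℤ} (hA : IsSimplyLacedCartan A)
    {w₀ : Function.End (I → ℤ)} {ν : ℕ} (hdist : ∀ a b c : K, a * (b + c) = a * b + a * c)
    {p q : (Fin ν → I) × (Fin ν → K)} (h : Adjacent A w₀ ν p q) (i : I) :
    letterSum i p = letterSum i q := by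
  obtain ⟨-, -, ⟨l, h0, h1, h2, hij, hp2, hq0, hq1, hq2, hoff, ha, hb, hc⟩ |
    ⟨l, h0, h1, -, hq0, hq1, hoff, ha, hb⟩⟩ := h
  · have hne : p.1 ⟨l, h0⟩ ≠ p.1 ⟨l + 1, h1⟩ := fun he => by
      rw [he, hA.diag] at hij
      omega
    refine sum_eq_sum_of_eq_off {⟨l, h0⟩, ⟨l + 1, h1⟩, ⟨l + 2, h2⟩} ?_ ?_
    · rw [Finset.sum_insert (by simp), Finset.sum_insert (by simp), Finset.sum_singleton,
        Finset.sum_insert (by simp), Finset.sum_insert (by simp), Finset.sum_singleton,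
        hp2, hq0, hq1, hq2, ha, hb, hc]
      set a := p.2 ⟨l, h0⟩
      set b := p.2 ⟨l + 1, h1⟩
      set c := p.2 ⟨l + 2, h2⟩
      have hsum : b * c * (a + c)⁻¹ + a * b * (a + c)⁻¹ = b := by
        rw [mul_comm (b * c), mul_comm (a * b), ← hdist, mul_comm a b, ← hdist, add_comm c a,
          mul_comm, mul_inv_cancel_right]
      by_cases hi : p.1 ⟨l, h0⟩ = i
      · have hj : p.1 ⟨l + 1, h1⟩ ≠ i := fun he => hne (hi.trans he.symm)
        simp only [if_pos hi, if_neg hj, zero_add, add_zero, WithZero.coe_add]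
      · by_cases hj : p.1 ⟨l + 1, h1⟩ = i
        · simp only [if_pos hj, if_neg hi, zero_add, add_zero, ← WithZero.coe_add, hsum]
        · simp only [if_neg hi, if_neg hj, add_zero]
    · intro k hk
      simp only [Finset.mem_insert, Finset.mem_singleton, Fin.ext_iff, not_or] at hk
      obtain ⟨e1, e2⟩ := hoff k hk.1 hk.2.1 hk.2.2
      rw [e1, e2]
  · refine sum_eq_sum_of_eq_off {⟨l, h0⟩, ⟨l + 1, h1⟩} ?_ ?_
    · rw [Finset.sum_pair (by simp), Finset.sum_pair (by simp), hq0, hq1, ha, hb, add_comm]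
    · intro k hk
      simp only [Finset.mem_insert, Finset.mem_singleton, Fin.ext_iff, not_or] at hk
      obtain ⟨e1, e2⟩ := hoff k hk.1 hk.2
      rw [e1, e2]

lemma letterSum_eq_of_eqvGen {A : Matrix I I ℤ} (hA : IsSimplyLacedCartan A)
    {w₀ : Function.End (I → ℤ)} {ν : ℕ} (hdist : ∀ a b c : K, a * (b + c) = a * b + a * c)
    {p q : (Fin ν → I) × (Fin ν → K)} (h : Relation.EqvGen (Adjacent A w₀ ν) p q) (i : I) :
    letterSum i p = letterSum i q := by
  induction h with
  | rel _ _ h => exact h.letterSum_eq hA hdist i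
  | refl _ => rfl
  | symm _ _ _ ih => exact ih.symm
  | trans _ _ _ _ _ ih₁ ih₂ => exact ih₁.trans ih₂

/-- Multiplication by `c` as an additive endomorphism of `K` with a zero adjoined. -/
def mulLeftWithZero (hdist : ∀ a b c : K, a * (b + c) = a * b + a * c) (c : K) :
    WithZero K →+ WithZero K where
  toFun x := c * x
  map_zero' := mul_zero _
  map_add' x y := by
    cases x with
    | zero => simp only [zero_add, mul_zero]
    | coe x =>
      cases y with
      | zero => simp only [add_zero, mul_zero]
      | coe y =>
        rw [← WithZero.coe_add, ← WithZero.coe_mul, hdist, WithZero.coe_add, WithZero.coe_mul,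
          WithZero.coe_mul]

omit [Fintype I] in
lemma letterSum_mul (hdist : ∀ a b c : K, a * (b + c) = a * b + a * c) {ν : ℕ}
    (c : I → K) (p : (Fin ν → I) × (Fin ν → K)) (i : I) :
    letterSum i (p.1, fun k => p.2 k * c (p.1 k)) = c i * letterSum i p := by
  change _ = mulLeftWithZero hdist (c i) _
  rw [letterSum, letterSum, map_sum]
  refine Finset.sum_congr rfl fun k _ => ?_
  dsimp only
  split_ifs with h
  · rw [h, mul_comm, WithZero.coe_mul]
    rfl
  · rw [map_zero]

omit [Fintype I] [CommGroup K] in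
lemma letterSum_ne_zero {ν : ℕ} {p : (Fin ν → I) × (Fin ν → K)} {i : I} {k : Fin ν}
    (hk : p.1 k = i) : letterSum i p ≠ 0 := by
  rw [letterSum, ← Finset.add_sum_erase _ _ (Finset.mem_univ k), if_pos hk]
  generalize (∑ x ∈ Finset.univ.erase k, _ : WithZero K) = y
  cases y with
  | zero => rw [add_zero]; exact WithZero.coe_ne_zero
  | coe y => rw [← WithZero.coe_add]; exact WithZero.coe_ne_zero

end LinearInvariant

/-- the action of `K^I` on `𝒰_K` given by
`(i,a) ↦ (i, (a_1 p_{i_1}, …, a_ν p_{i_ν}))` is free. -/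
theorem action_free (A : Matrix I I ℤ) (hA : IsSimplyLacedCartan A)
    (w₀ : Function.End (I → ℤ)) (ν : ℕ) (hw : IsLongest A w₀ ν)
    {K : Type*} [CommGroup K] [AddCommSemigroup K]
    (hdist : ∀ a b c : K, a * (b + c) = a * b + a * c)
    (pv : I → K) (p : (Fin ν → I) × (Fin ν → K)) (hp : p.1 ∈ RedWord A w₀ ν)
    (hfix : Relation.EqvGen (Adjacent A w₀ ν) p
      (p.1, fun k => p.2 k * pv (p.1 k))) :
    ∀ i : I, pv i = 1 := by
  intro i
  obtain ⟨k, hk⟩ : ∃ k, p.1 k = i := by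
    simpa [List.mem_ofFn] using hA.mem_of_isLongest hw (l := List.ofFn p.1) hp i
  have h := letterSum_eq_of_eqvGen hA hdist hfix i
  rw [letterSum_mul hdist] at h
  have h1 : ((pv i : K) : WithZero K) = 1 :=
    mul_right_cancel₀ (letterSum_ne_zero hk) (h.symm.trans (one_mul _).symm)
  exact WithZero.coe_inj.1 h1

end Lusztig
end
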